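/- arXiv:2002.05094 — 6 statements merged into one kernel-verified Lean document; each statement's English description precedes it below -/
import Mathlib

section
/- Let (a_n)_{n∈ℤ} be positive reals with Σ_{n∈ℤ} (√(a_{n-1}) − √(a_n))² < ∞. Then for η-almost every y = (y_n)_{n∈ℤ} ∈ ℕ^ℤ the limit lim_{N→∞} ∏_{n=-N}^{N} ( Pois(a_{n-1})({y_n}) / Pois(a_n)({y_n}) ) exists, and this limit equals the Radon–Nikodym derivative of ⊗_{n∈ℤ} Pois(a_{n-1}) with respect to η at y. -/
open MeasureTheory ProbabilityTheory Filter

/-- The Poisson distribution on `ℕ` with parameter (rate) `a`. -/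
noncomputable def pois (a : ℝ) : Measure ℕ := poissonMeasure a.toNNReal

/-- `IsProductOf η μ` says that `η` is the infinite product `⊗_{i} μ i` of the probability
measures `μ i`, i.e. `η` gives each cylinder set the corresponding product value. -/
def IsProductOf {ι : Type*} [MeasurableSpace ι] (η : Measure (ι → ℕ)) (μ : ι → Measure ℕ) : Prop :=
  ∀ (F : Finset ι) (v : ι → ℕ), η {y | ∀ i ∈ F, y i = v i} = ∏ i ∈ F, μ i {v i}

lemma aux_discrete {C : Type*} [MeasurableSpace C] [MeasurableSingletonClass C]
    (μ ν : Measure C) [IsFiniteMeasure μ] [IsFiniteMeasure ν] (h : μ ≪ ν) (c : C) :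
    (μ.rnDeriv ν c).toReal * (ν {c}).toReal = (μ {c}).toReal := by
  rw [← Measure.setLIntegral_rnDeriv h {c}, ← ENNReal.toReal_mul]
  simp [mul_comm]

lemma aux_limit {Ω : Type*} [m0 : MeasurableSpace Ω] (η η' : Measure Ω) [IsFiniteMeasure η]
    [IsFiniteMeasure η'] (C : ℕ → Type*) [∀ n, Countable (C n)] [∀ n, MeasurableSpace (C n)]
    [∀ n, MeasurableSingletonClass (C n)] (X : ∀ n, Ω → C n) (hX : ∀ n, Measurable (X n))
    (ℱ : Filtration ℕ m0) (hℱ : ∀ n, ℱ n = MeasurableSpace.comap (X n) inferInstance)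
    (htop : ⨆ n, ℱ n = m0) :
    ∀ᵐ y ∂η, Tendsto (fun n : ℕ => (η' (X n ⁻¹' {X n y})).toReal / (η (X n ⁻¹' {X n y})).toReal)
      atTop (nhds ((η'.rnDeriv η y).toReal)) := by
  set ρ := η' + η with hρ
  have h1 : η ≪ ρ := Measure.absolutelyContinuous_of_le (Measure.le_add_left le_rfl)
  have h2 : η' ≪ ρ := Measure.absolutelyContinuous_of_le (Measure.le_add_right le_rfl)
  have key : ∀ (μ : Measure Ω) [IsFiniteMeasure μ], μ ≪ ρ → ∀ᵐ y ∂η,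
      Tendsto (fun n => ((μ.map (X n)).rnDeriv (ρ.map (X n)) (X n y)).toReal) atTop
        (nhds ((μ.rnDeriv ρ y).toReal)) := by
    intro μ _ hμ
    have hl := Integrable.tendsto_ae_condExp (μ := ρ) (ℱ := ℱ)
      (g := fun y => (μ.rnDeriv ρ y).toReal) Measure.integrable_toReal_rnDeriv (by
        rw [htop]; exact (Measure.measurable_rnDeriv μ ρ).ennreal_toReal.stronglyMeasurable)
    have hc := fun n => toReal_rnDeriv_map hμ (hX n)
    apply h1.ae_le
    filter_upwards [hl, ae_all_iff.2 hc] with y hy hyc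
    refine hy.congr fun n => ?_
    rw [hℱ n, hyc n]
  have hnz : ∀ᵐ y ∂η, ∀ n, ∀ c : C n, η (X n ⁻¹' {c}) = 0 → X n y ≠ c := by
    refine ae_all_iff.2 fun n => ae_all_iff.2 fun c => ?_
    by_cases h : η (X n ⁻¹' {c}) = 0
    · have : ∀ᵐ y ∂η, y ∉ X n ⁻¹' {c} := measure_eq_zero_iff_ae_notMem.1 h
      filter_upwards [this] with y hy _ hc using hy hc
    · simp [h]
  filter_upwards [key η h1, key η' h2, Measure.rnDeriv_pos h1,
    h1.ae_le (Measure.rnDeriv_lt_top η ρ), Measure.rnDeriv_eq_div h2 h1, hnz] with y k1 k2 hpos hlt hdiv hnz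
  rw [hdiv, ENNReal.toReal_div]
  refine (k2.div k1 (ENNReal.toReal_pos hpos.ne' hlt.ne).ne').congr fun n => ?_
  have e1 := aux_discrete _ _ (h1.map (hX n)) (X n y)
  have e2 := aux_discrete _ _ (h2.map (hX n)) (X n y)
  rw [Measure.map_apply (hX n) (measurableSet_singleton _),
    Measure.map_apply (hX n) (measurableSet_singleton _)] at e1 e2
  rw [← e1, ← e2]
  by_cases h0 : (ρ (X n ⁻¹' {X n y})).toReal = 0
  · exfalso
    refine hnz n (X n y) (h1 ?_) rfl
    exact ((ENNReal.toReal_eq_zero_iff _).1 h0).resolve_right (measure_ne_top _ _)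
  · rw [mul_div_mul_right _ _ h0]
    rfl

/-- Let `(a_n)_{n∈ℤ}` be positive reals with `Σ_{n∈ℤ} (√(a_{n-1}) - √(a_n))² < ∞`.  Then for
`η`-a.e. `y ∈ ℕ^ℤ` the limit `lim_N ∏_{n=-N}^N Pois(a_{n-1}){y n} / Pois(a_n){y n}` exists
and equals the Radon–Nikodym derivative of `η' = ⊗_{n} Pois(a_{n-1})` w.r.t.
`η = ⊗_n Pois(a_n)` at `y`. -/
theorem stmt4 (a : ℤ → ℝ) (ha : ∀ n, 0 < a n)
    (hsum : Summable fun n : ℤ => (Real.sqrt (a (n - 1)) - Real.sqrt (a n)) ^ 2)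
    (η η' : Measure (ℤ → ℕ)) [IsProbabilityMeasure η] [IsProbabilityMeasure η']
    (hη : IsProductOf η fun n => pois (a n))
    (hη' : IsProductOf η' fun n => pois (a (n - 1))) :
    ∀ᵐ y ∂η, Tendsto
      (fun N : ℕ => ∏ n ∈ Finset.Icc (-(N : ℤ)) (N : ℤ),
        (pois (a (n - 1)) {y n}).toReal / (pois (a n) {y n}).toReal)
      atTop (nhds ((η'.rnDeriv η y).toReal)) := by
  let I : ℕ → Finset ℤ := fun N => Finset.Icc (-(N : ℤ)) (N : ℤ)
  have hI : Monotone I := by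
    intro m n h
    apply Finset.Icc_subset_Icc <;> omega
  let ℱ : Filtration ℕ (MeasurableSpace.pi : MeasurableSpace (ℤ → ℕ)) :=
    { seq := fun n => Filtration.piFinset (X := fun _ : ℤ => ℕ) (I n)
      mono' := fun m n h => Filtration.piFinset.mono (hI h)
      le' := fun n => Filtration.piFinset.le _ }
  have htop : ⨆ n, ℱ n = (MeasurableSpace.pi : MeasurableSpace (ℤ → ℕ)) := by
    apply le_antisymm (iSup_le fun n => ℱ.le n)
    refine iSup_le fun i => ?_
    refine le_trans ?_ (le_iSup (fun n => ℱ n) i.natAbs)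
    have hi : i ∈ I i.natAbs := by simp only [I, Finset.mem_Icc]; omega
    rw [show (fun b : ℤ → ℕ => b i) = (fun z : (I i.natAbs) → ℕ => z ⟨i, hi⟩) ∘
      (I i.natAbs).restrict from rfl, ← MeasurableSpace.comap_comp]
    exact MeasurableSpace.comap_mono (measurable_pi_apply _).comap_le
  have H := aux_limit η η' (fun n => (I n) → ℕ) (fun n => (I n).restrict)
    (fun n => Finset.measurable_restrict _) ℱ (fun n => rfl) htop
  filter_upwards [H] with y hy
  refine hy.congr fun n => ?_
  have hset : (I n).restrict (π := fun _ => ℕ) ⁻¹' {(I n).restrict (π := fun _ => ℕ) y} = {z : ℤ → ℕ | ∀ i ∈ I n, z i = y i} := by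
    ext z
    simp [funext_iff]
  rw [hset, hη, hη', ENNReal.toReal_prod, ENNReal.toReal_prod, ← Finset.prod_div_distrib]
end

section
/- Let (a_n)_{n∈ℤ} be positive reals with Σ_{n∈ℤ} |a_{n-1} − a_n| < ∞. Then the limits a_{+∞} := lim_{n→+∞} a_n and a_{-∞} := lim_{n→-∞} a_n exist, and if a_{+∞} ≠ a_{-∞}, then the shift σ on (ℕ^ℤ, η) is totally dissipative. -/
open MeasureTheory ProbabilityTheory Filter

/-- The two-sided shift `(σ y)_n = y_{n+1}` on `ℕ^ℤ`, as an invertible transformation. -/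
def shift : Equiv.Perm (ℤ → ℕ) where
  toFun y n := y (n + 1)
  invFun y n := y (n - 1)
  left_inv y := funext fun n => by simp
  right_inv y := funext fun n => by simp

/-- A transformation `S` of `(Y,ν)` is totally dissipative if there is a measurable set `B`
whose `S^n`-images, `n ∈ ℤ`, are pairwise disjoint and cover `Y` up to a `ν`-null set. -/
def TotallyDissipative {Y : Type*} [MeasurableSpace Y] (S : Equiv.Perm Y)
    (ν : Measure Y) : Prop :=
  ∃ B : Set Y, MeasurableSet B ∧
    (Pairwise fun m n : ℤ => Disjoint (⇑(S ^ m) '' B) (⇑(S ^ n) '' B)) ∧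
    ν (Set.univ \ ⋃ n : ℤ, ⇑(S ^ n) '' B) = 0


instance pois_prob (a : ℝ) : IsProbabilityMeasure (pois a) := by
  unfold pois; infer_instance

theorem pois_lintegral (a : ℝ) (ha : 0 < a) (u c : ℝ) :
    ∫⁻ x : ℕ, ENNReal.ofReal (Real.exp (u * ((x : ℝ) - c))) ∂(pois a)
      = ENNReal.ofReal (Real.exp (a * (Real.exp u - 1) - u * c)) := by
  have hc : ((a.toNNReal : NNReal) : ℝ) = a := Real.coe_toNNReal a ha.le
  have h1 := (NormedSpace.expSeries_div_hasSum_exp (a * Real.exp u)).mul_left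
    (Real.exp (-a - u * c))
  rw [← Real.exp_eq_exp_ℝ, ← Real.exp_add] at h1
  unfold pois poissonMeasure
  rw [lintegral_sum_measure]
  simp only [lintegral_smul_measure, lintegral_dirac, hc, smul_eq_mul]
  have h2 : ∀ n : ℕ, ENNReal.ofReal (Real.exp (-a) * a ^ n / (n.factorial : ℝ)) *
      ENNReal.ofReal (Real.exp (u * ((n : ℝ) - c))) =
      ENNReal.ofReal (Real.exp (-a - u * c) * ((a * Real.exp u) ^ n / (n.factorial : ℝ))) := by
    intro n
    rw [← ENNReal.ofReal_mul (by positivity)]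
    congr 1
    rw [mul_pow, ← Real.exp_nat_mul, show u * ((n : ℝ) - c) = n * u + -(u * c) by ring,
      Real.exp_add, sub_eq_add_neg (-a), Real.exp_add (-a)]
    ring
  simp_rw [h2]
  rw [← ENNReal.ofReal_tsum_of_nonneg (fun n => by positivity) h1.summable, h1.tsum_eq]
  congr 2
  ring

theorem prod_eq_infinitePi (μ : ℤ → Measure ℕ) [∀ i, IsProbabilityMeasure (μ i)]
    (η : Measure (ℤ → ℕ)) (hη : IsProductOf η μ) : η = Measure.infinitePi μ := by
  refine IsProjectiveLimit.unique (P := fun I : Finset ℤ => Measure.pi (fun i : I => μ i)) ?_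
    (Measure.isProjectiveLimit_infinitePi μ)
  intro I
  rw [Measure.ext_iff_singleton]
  intro v
  classical
  rw [Measure.map_apply (by fun_prop) (measurableSet_singleton v), Measure.pi_singleton]
  have := hη I (fun i => if h : i ∈ I then v ⟨i, h⟩ else 0)
  rw [← Finset.prod_attach] at this
  simp only [Finset.coe_mem, dite_true, Subtype.coe_eta] at this
  rw [Finset.univ_eq_attach, ← this]
  congr 1
  ext y
  simp only [Set.mem_preimage, Set.mem_singleton_iff, Set.mem_ofPred_eq, funext_iff,
    Finset.restrict, Subtype.forall]
  exact forall₂_congr fun i hi => by simp [hi]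

theorem exists_t (b c s : ℝ) (h : 0 < s * (b - c)) :
    ∃ t : ℝ, 0 < t ∧ b * (Real.exp (-t * s) - 1) - (-t * s) * c < 0 := by
  have hd : HasDerivAt (fun t : ℝ => b * (Real.exp (-t * s) - 1) - (-t * s) * c)
      (-(s * (b - c))) 0 := by
    have h0 : HasDerivAt (fun t : ℝ => -t * s) (-1 * s) 0 := (hasDerivAt_neg 0).mul_const s
    have h1 := ((h0.exp.sub_const 1).const_mul b).sub (h0.mul_const c)
    refine HasDerivAt.congr_deriv h1 ?_
    rw [neg_zero, zero_mul, Real.exp_zero]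
    ring
  have h2 := hd.tendsto_slope
  have h3 : ∀ᶠ t in nhdsWithin (0 : ℝ) {0}ᶜ, slope (fun t : ℝ => b * (Real.exp (-t * s) - 1) - (-t * s) * c) 0 t < 0 :=
    h2.eventually_lt_const (by linarith)
  have h4 : ∀ᶠ t in nhdsWithin (0 : ℝ) (Set.Ioi 0), slope (fun t : ℝ => b * (Real.exp (-t * s) - 1) - (-t * s) * c) 0 t < 0 :=
    h3.filter_mono (nhdsWithin_mono _ (fun x hx => ne_of_gt hx))
  obtain ⟨t, ht, ht0⟩ := (h4.and self_mem_nhdsWithin).exists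
  refine ⟨t, ht0, ?_⟩
  have ht0' : 0 < t := ht0
  rw [slope_def_field] at ht
  simp only [neg_zero, zero_mul, Real.exp_zero, sub_self, mul_zero, sub_zero] at ht
  by_contra hcon
  push Not at hcon
  exact absurd ht (not_lt.mpr (div_nonneg hcon ht0'.le))

theorem ae_tendsto (a : ℤ → ℝ) (ha : ∀ n, 0 < a n)
    (η : Measure (ℤ → ℕ)) [IsProbabilityMeasure η]
    (hη : IsProductOf η fun n => pois (a n)) (k : ℕ → ℤ) (hk : Function.Injective k)
    (b c s : ℝ) (hb : Tendsto (fun n => a (k n)) atTop (nhds b)) (h : 0 < s * (b - c)) :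
    ∀ᵐ y ∂η, Tendsto (fun n => ∑ i ∈ Finset.range n, s * ((y (k i) : ℝ) - c)) atTop atTop := by
  obtain ⟨t, ht, htD⟩ := exists_t b c s h
  set u := -t * s with hu
  have hηe := prod_eq_infinitePi (fun n => pois (a n)) η hη
  let X : ℤ → (ℤ → ℕ) → ENNReal := fun i y => ENNReal.ofReal (Real.exp (u * ((y i : ℝ) - c)))
  have hXm : ∀ i, Measurable (X i) := fun i => by
    have : Measurable (fun x : ℕ => ENNReal.ofReal (Real.exp (u * ((x : ℝ) - c)))) :=
      measurable_of_countable _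
    exact this.comp (measurable_pi_apply i)
  have hind : iIndepFun X η := by
    rw [hηe]
    exact iIndepFun_infinitePi
      (X := fun _ (x : ℕ) => ENNReal.ofReal (Real.exp (u * ((x : ℝ) - c))))
      (fun i => measurable_of_countable _)
  have hind2 : iIndepFun (fun n => X (k n)) η := hind.precomp hk
  have hint : ∀ i, ∫⁻ y, X i y ∂η =
      ENNReal.ofReal (Real.exp (a i * (Real.exp u - 1) - u * c)) := by
    intro i
    rw [← pois_lintegral (a i) (ha i) u c]
    rw [← Measure.infinitePi_map_eval (fun n => pois (a n)) i, ← hηe, lintegral_map]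
    · exact measurable_of_countable _
    · exact measurable_pi_apply i
  let d : ℕ → ℝ := fun n => a (k n) * (Real.exp u - 1) - u * c
  have hsumm : Summable (fun n => Real.exp (∑ i ∈ Finset.range n, d i)) := by
    refine summable_of_ratio_test_tendsto_lt_one
      (l := Real.exp (b * (Real.exp u - 1) - u * c)) (by simpa using htD)
      (Eventually.of_forall fun n => (Real.exp_pos _).ne') ?_
    have : ∀ n, ‖Real.exp (∑ i ∈ Finset.range (n+1), d i)‖ / ‖Real.exp (∑ i ∈ Finset.range n, d i)‖
        = Real.exp (d n) := by
      intro n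
      rw [Real.norm_eq_abs, Real.norm_eq_abs, Real.abs_exp, Real.abs_exp, ← Real.exp_sub,
        Finset.sum_range_succ]
      congr 1; ring
    simp_rw [this]
    exact (Real.continuous_exp.tendsto _).comp ((hb.mul_const _).sub_const _)
  have hfin : ∫⁻ y, ∑' n, ∏ i ∈ Finset.range n, X (k i) y ∂η ≠ ⊤ := by
    rw [lintegral_tsum (fun n => (Finset.measurable_prod _ fun i _ => hXm (k i)).aemeasurable)]
    have : ∀ n, ∫⁻ y, ∏ i ∈ Finset.range n, X (k i) y ∂η =
        ENNReal.ofReal (Real.exp (∑ i ∈ Finset.range n, d i)) := by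
      intro n
      rw [lintegral_prod_eq_prod_lintegral_of_indepFun _ _ hind2 (fun i => hXm _)]
      simp_rw [hint]
      rw [Real.exp_sum, ENNReal.ofReal_prod_of_nonneg (fun i _ => (Real.exp_pos _).le)]
    simp_rw [this]
    exact hsumm.tsum_ofReal_ne_top
  have hae := ae_lt_top (Measurable.tsum
    (fun n => Finset.measurable_prod (Finset.range n) fun i _ => hXm (k i))) hfin
  filter_upwards [hae] with y hy
  have h0 := ENNReal.tendsto_atTop_zero_of_tsum_ne_top hy.ne
  have he : ∀ n, ∏ i ∈ Finset.range n, X (k i) y =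
      ENNReal.ofReal (Real.exp (-t * ∑ i ∈ Finset.range n, s * ((y (k i) : ℝ) - c))) := by
    intro n
    rw [Finset.mul_sum, Real.exp_sum, ENNReal.ofReal_prod_of_nonneg (fun i _ => (Real.exp_pos _).le)]
    refine Finset.prod_congr rfl fun i _ => ?_
    simp only [X, hu]
    congr 2; ring
  simp_rw [he] at h0
  have h1 := (ENNReal.tendsto_toReal ENNReal.zero_ne_top).comp h0
  simp only [Function.comp_def, ENNReal.toReal_ofReal (Real.exp_pos _).le, ENNReal.toReal_zero] at h1
  rw [Real.tendsto_exp_comp_nhds_zero] at h1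
  have h2 := (tendsto_neg_atBot_atTop.comp h1)
  have h3 := h2.const_mul_atTop (inv_pos.mpr ht)
  refine h3.congr fun n => ?_
  simp only [Function.comp]
  field_simp

noncomputable def coc (s c : ℝ) (y : ℤ → ℕ) (n : ℤ) : ℝ :=
  ∑ i ∈ Finset.range n.toNat, s * ((y (i : ℤ) : ℝ) - c)
    + ∑ i ∈ Finset.range (-n).toNat, -s * ((y (-1 - (i : ℤ)) : ℝ) - c)

theorem coc_zero (s c : ℝ) (y : ℤ → ℕ) : coc s c y 0 = 0 := by simp [coc]

theorem coc_succ (s c : ℝ) (y : ℤ → ℕ) (n : ℤ) :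
    coc s c y (n + 1) = coc s c y n + s * ((y n : ℝ) - c) := by
  unfold coc
  rcases le_or_gt 0 n with hn | hn
  · rw [show (n + 1).toNat = n.toNat + 1 by omega, show (-(n + 1)).toNat = 0 by omega,
      show (-n).toNat = 0 by omega, Finset.sum_range_succ, Int.toNat_of_nonneg hn]
    simp
  · rw [show (n + 1).toNat = 0 by omega, show n.toNat = 0 by omega,
      show (-n).toNat = (-(n + 1)).toNat + 1 by omega, Finset.sum_range_succ,
      show -1 - (((-(n + 1)).toNat : ℕ) : ℤ) = n by omega]
    ring

theorem shift_zpow (m : ℤ) (y : ℤ → ℕ) (n : ℤ) : (shift ^ m) y n = y (n + m) := by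
  induction m using Int.induction_on generalizing n with
  | zero => simp
  | succ i ih =>
    rw [add_comm (i : ℤ) 1, zpow_add, Equiv.Perm.mul_apply, zpow_one]
    change (shift ^ (i : ℤ)) y (n + 1) = _
    rw [ih]; congr 1; ring
  | pred i ih =>
    rw [sub_eq_add_neg, add_comm, zpow_add, Equiv.Perm.mul_apply, zpow_neg_one]
    change (shift ^ (-(i : ℤ))) y (n - 1) = _
    rw [ih]; congr 1; ring

theorem coc_shift (s c : ℝ) (y : ℤ → ℕ) (m n : ℤ) :
    coc s c ((shift ^ m) y) n = coc s c y (n + m) - coc s c y m := by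
  induction n using Int.induction_on with
  | zero => simp [coc_zero]
  | succ i ih =>
    rw [coc_succ, ih, shift_zpow, show (i : ℤ) + 1 + m = (i + m) + 1 by ring, coc_succ s c y]
    ring
  | pred i ih =>
    have h1 := coc_succ s c ((shift ^ m) y) (-(i : ℤ) - 1)
    have h2 := coc_succ s c y (-(i : ℤ) - 1 + m)
    rw [shift_zpow, sub_add_cancel, ih] at h1
    rw [show -(i : ℤ) - 1 + m + 1 = -(i : ℤ) + m by ring] at h2
    linarith

theorem coc_measurable (s c : ℝ) (n : ℤ) : Measurable (fun y => coc s c y n) := by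
  have : ∀ j : ℤ, Measurable (fun y : ℤ → ℕ => ((y j : ℕ) : ℝ)) := fun j =>
    (measurable_of_countable (fun x : ℕ => (x : ℝ))).comp (measurable_pi_apply j)
  unfold coc
  refine Measurable.add ?_ ?_ <;> refine Finset.measurable_sum _ fun i _ => ?_
  · exact ((this _).sub_const c).const_mul s
  · exact ((this _).sub_const c).const_mul (-s)

theorem dissip_of (s c : ℝ) (η : Measure (ℤ → ℕ))
    (h : ∀ᵐ y ∂η, Tendsto (coc s c y) cofinite atTop) : TotallyDissipative shift η := by
  refine ⟨{y | ∀ n : ℤ, (n < 0 → 0 < coc s c y n) ∧ 0 ≤ coc s c y n}, ?_, ?_, ?_⟩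
  · rw [Set.ofPred_forall]
    refine MeasurableSet.iInter fun n => ?_
    have hle : MeasurableSet {y | (0 : ℝ) ≤ coc s c y n} :=
      measurableSet_le measurable_const (coc_measurable s c n)
    have hlt : MeasurableSet {y | (0 : ℝ) < coc s c y n} :=
      measurableSet_lt measurable_const (coc_measurable s c n)
    by_cases hn : n < 0
    · simp only [hn, true_imp_iff]
      exact hlt.inter hle
    · simp only [hn, false_imp_iff, true_and]
      exact hle
  · have key : ∀ m n : ℤ, m < n → ∀ x x' : ℤ → ℕ,
        (∀ n : ℤ, (n < 0 → 0 < coc s c x n) ∧ 0 ≤ coc s c x n) →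
        (∀ n : ℤ, (n < 0 → 0 < coc s c x' n) ∧ 0 ≤ coc s c x' n) →
        (shift ^ m) x = (shift ^ n) x' → False := by
      intro m n hmn x x' hx hx' he
      have hxx : x = (shift ^ (n - m)) x' := by
        rw [sub_eq_neg_add, zpow_add, Equiv.Perm.mul_apply, ← he, ← Equiv.Perm.mul_apply,
          ← zpow_add]
        simp
      have h1 := (hx (m - n)).1 (by omega)
      rw [hxx, coc_shift, sub_add_sub_cancel', sub_self, coc_zero] at h1
      have h2 := (hx' (n - m)).2
      linarith
    intro m n hmn
    rw [Set.disjoint_left]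
    rintro z ⟨x, hx, rfl⟩ ⟨x', hx', he⟩
    rcases lt_or_gt_of_ne hmn with hlt | hlt
    · exact key m n hlt x x' hx hx' he.symm
    · exact key n m hlt x' x hx' hx he
  · rw [← Set.compl_eq_univ_sdiff]
    change ∀ᵐ y ∂η, _
    filter_upwards [h] with y hy
    obtain ⟨p, hp⟩ := hy.exists_forall_le
    have hbot : Tendsto (coc s c y) atBot atTop :=
      hy.mono_left (by rw [Int.cofinite_eq]; exact le_sup_left)
    obtain ⟨b, hb⟩ := eventually_atBot.mp (hbot.eventually_gt_atTop (coc s c y p))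
    obtain ⟨q, hq, hqm⟩ := Int.exists_least_of_bdd (P := fun z => coc s c y z ≤ coc s c y p)
      ⟨b, fun z hz => by
        by_contra hcon
        exact absurd (hb z (by omega)) (not_lt.mpr hz)⟩ ⟨p, le_rfl⟩
    refine Set.mem_iUnion.mpr ⟨-q, (shift ^ q) y, ?_, ?_⟩
    · intro n
      rw [coc_shift]
      refine ⟨fun hn => ?_, ?_⟩
      · by_contra hcon
        have := hqm (n + q) (by linarith)
        omega
      · have := hp (n + q)
        linarith
    · rw [← Equiv.Perm.mul_apply, ← zpow_add]
      simp

theorem tendsto_atBot_of {β : Type*} (f : ℤ → β) (l : Filter β)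
    (h : Tendsto (fun n : ℕ => f (-(n : ℤ))) atTop l) : Tendsto f atBot l := by
  have h1 : Tendsto (fun n : ℤ => f (-n)) atTop l := by
    rw [← Nat.map_cast_int_atTop, tendsto_map'_iff]; exact h
  have := h1.comp (tendsto_neg_atBot_atTop (G := ℤ))
  simpa [Function.comp_def] using this

theorem tendsto_atTop_of {β : Type*} (f : ℤ → β) (l : Filter β)
    (h : Tendsto (fun n : ℕ => f (n : ℤ)) atTop l) : Tendsto f atTop l := by
  rw [← Nat.map_cast_int_atTop, tendsto_map'_iff]; exact h

/-- Let `(a_n)_{n∈ℤ}` be positive reals with `Σ_{n∈ℤ} |a_{n-1} - a_n| < ∞`.  Then the limits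
`a_{+∞} = lim_{n→+∞} a_n` and `a_{-∞} = lim_{n→-∞} a_n` exist, and if `a_{+∞} ≠ a_{-∞}` then
the shift on `(ℕ^ℤ, η)`, `η = ⊗_{n∈ℤ} Pois(a_n)`, is totally dissipative. -/
theorem stmt7 (a : ℤ → ℝ) (ha : ∀ n, 0 < a n)
    (hsum : Summable fun n : ℤ => |a (n - 1) - a n|)
    (η : Measure (ℤ → ℕ)) [IsProbabilityMeasure η]
    (hη : IsProductOf η fun n => pois (a n)) :
    ∃ aplus aminus : ℝ, Tendsto a atTop (nhds aplus) ∧ Tendsto a atBot (nhds aminus) ∧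
      (aplus ≠ aminus → TotallyDissipative shift η) := by
  have hc1 : CauchySeq (fun n : ℕ => a (n : ℤ)) := by
    apply cauchySeq_of_summable_dist
    have := hsum.comp_injective (i := fun n : ℕ => (n : ℤ) + 1)
      (fun x y h => by simpa using h)
    refine this.congr fun n => ?_
    simp [Real.dist_eq]
  have hc2 : CauchySeq (fun n : ℕ => a (-(n : ℤ))) := by
    apply cauchySeq_of_summable_dist
    have := hsum.comp_injective (i := fun n : ℕ => -(n : ℤ))
      (fun x y h => by simpa using h)
    refine this.congr fun n => ?_
    rw [Real.dist_eq, abs_sub_comm]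
    simp only [Function.comp]
    congr 3
    push_cast; ring_nf
  obtain ⟨p, hp⟩ := cauchySeq_tendsto_of_complete hc1
  obtain ⟨q, hq⟩ := cauchySeq_tendsto_of_complete hc2
  refine ⟨p, q, tendsto_atTop_of _ _ hp, tendsto_atBot_of _ _ hq, fun hne => ?_⟩
  have hpos : 0 < (p - q) * (p - q) := mul_self_pos.mpr (sub_ne_zero.mpr hne)
  apply dissip_of (p - q) ((p + q) / 2) η
  have h1 := ae_tendsto a ha η hη (fun n => (n : ℤ)) (fun x y h => by simpa using h) p
    ((p + q) / 2) (p - q) hp (by nlinarith)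
  have h2 := ae_tendsto a ha η hη (fun n => -1 - (n : ℤ)) (fun x y h => by simpa using h) q
    ((p + q) / 2) (-(p - q)) (by
      refine ((tendsto_add_atTop_iff_nat 1).mpr hq).congr fun n => ?_
      congr 1; push_cast; ring) (by nlinarith)
  filter_upwards [h1, h2] with y hy1 hy2
  rw [Int.cofinite_eq]
  refine Tendsto.sup (tendsto_atBot_of _ _ ?_) (tendsto_atTop_of _ _ ?_)
  · refine hy2.congr fun n => ?_
    simp [coc]
  · refine hy1.congr fun n => ?_
    simp [coc]
end

section
/- Let a > 0 and let (ε_j)_{j≥1} satisfy ε_j → 0, Σ_{j≥1} ε_j² = ∞ and Σ_{j≥1} ε_j⁴ < ∞. For n large enough that Σ_{j=1}^n ε_j² > 0, set β_n := (Σ_{j=1}^n ε_j²)^{-1/2} and Y_n := β_n Σ_{j=1}^n ( X_j − aε_j(1 − e^{ε_j}) ). Then for every t ∈ ℝ, the characteristic functions converge: E_η[e^{itY_n}] → e^{-a t²} as n → ∞; consequently (Y_n) converges in distribution to a centered Gaussian random variable with variance 2a. -/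
open MeasureTheory ProbabilityTheory Filter

/-- `IsProductOf' η μ` says that `η` is the infinite product `⊗_j μ j` of the probability
measures `μ j` on `ℕ × ℕ`, i.e. `η` gives each cylinder set the corresponding product value. -/
def IsProductOf' (η : Measure (ℕ → ℕ × ℕ)) (μ : ℕ → Measure (ℕ × ℕ)) : Prop :=
  ∀ (F : Finset ℕ) (v : ℕ → ℕ × ℕ), η {z | ∀ j ∈ F, z j = v j} = ∏ j ∈ F, μ j {v j}


lemma aux_pois (a : ℝ) (ha : 0 ≤ a) (s : ℝ) :
    ∫ k : ℕ, Complex.exp (((s * k : ℝ) : ℂ) * Complex.I) ∂(pois a)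
      = Complex.exp (a * (Complex.exp (s * Complex.I) - 1)) := by
  have h := charFun_map_cast_poissonMeasure a.toNNReal s
  rw [charFun_apply_real, integral_map .of_discrete (by fun_prop)] at h
  rw [Real.coe_toNNReal a ha] at h
  rw [← h]
  simp [pois]

lemma aux_pair (a b : ℝ) (ha : 0 ≤ a) (hb : 0 ≤ b) (s : ℝ) :
    ∫ p : ℕ × ℕ, Complex.exp (((s * ((p.2 : ℝ) - p.1) : ℝ) : ℂ) * Complex.I) ∂((pois b).prod (pois a))
      = Complex.exp (b * (Complex.exp (-(s * Complex.I)) - 1) + a * (Complex.exp (s * Complex.I) - 1)) := by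
  have hsf1 : IsProbabilityMeasure (pois a) := by unfold pois; infer_instance
  have hsf2 : IsProbabilityMeasure (pois b) := by unfold pois; infer_instance
  have h1 : ∀ p : ℕ × ℕ, Complex.exp (((s * ((p.2 : ℝ) - p.1) : ℝ) : ℂ) * Complex.I)
      = Complex.exp ((((-s) * (p.1 : ℝ) : ℝ) : ℂ) * Complex.I) *
        Complex.exp (((s * (p.2 : ℝ) : ℝ) : ℂ) * Complex.I) := by
    intro p
    rw [← Complex.exp_add]
    congr 1
    push_cast
    ring
  simp_rw [h1]
  rw [integral_prod_mul (fun k : ℕ => Complex.exp ((((-s) * (k : ℝ) : ℝ) : ℂ) * Complex.I))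
    (fun k : ℕ => Complex.exp (((s * (k : ℝ) : ℝ) : ℂ) * Complex.I)), aux_pois b hb, aux_pois a ha,
    ← Complex.exp_add]
  congr 1
  push_cast
  ring_nf

lemma aux_map (η : Measure (ℕ → ℕ × ℕ)) (μ : ℕ → Measure (ℕ × ℕ)) [∀ j, IsProbabilityMeasure (μ j)]
    (hη : IsProductOf' η μ) (F : Finset ℕ) :
    η.map (fun z (j : F) => z j) = Measure.pi (fun j : F => μ j) := by
  refine Measure.ext_of_singleton fun v => ?_
  rw [Measure.map_apply (by fun_prop) (measurableSet_singleton v), Measure.pi_singleton]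
  have h := hη F (fun j => if h : j ∈ F then v ⟨j, h⟩ else 0)
  rw [← Finset.prod_coe_sort F] at h
  convert h using 1
  · congr 1
    ext z
    simp only [Set.mem_preimage, Set.mem_singleton_iff, Set.mem_ofPred_eq, funext_iff, Subtype.forall]
    refine forall₂_congr fun j hj => ?_
    simp [hj]
  · simp

lemma aux_prod (η : Measure (ℕ → ℕ × ℕ)) (μ : ℕ → Measure (ℕ × ℕ)) [∀ j, IsProbabilityMeasure (μ j)]
    (hη : IsProductOf' η μ) (F : Finset ℕ) (f : ℕ → ℕ × ℕ → ℂ) :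
    ∫ z, ∏ j ∈ F, f j (z j) ∂η = ∏ j ∈ F, ∫ p, f j p ∂(μ j) := by
  have h1 : ∀ z : ℕ → ℕ × ℕ, ∏ j ∈ F, f j (z j)
      = (fun w : F → ℕ × ℕ => ∏ j : F, f j (w j)) ((fun z (j : F) => z j) z) := by
    intro z
    exact (Finset.prod_coe_sort F (fun j => f j (z j))).symm
  rw [integral_congr_ae (Eventually.of_forall h1)]
  have hm : Measurable (fun (z : ℕ → ℕ × ℕ) (j : F) => z j) :=
    measurable_pi_lambda _ fun j => measurable_pi_apply (j : ℕ)
  rw [← integral_map (φ := fun (z : ℕ → ℕ × ℕ) (j : F) => z j)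
    hm.aemeasurable
    (Measurable.of_discrete.aestronglyMeasurable) (f := fun w : F → ℕ × ℕ => ∏ j : F, f j (w j)), aux_map η μ hη F,
    integral_fintype_prod_eq_prod (fun (j : F) => f j)]
  exact Finset.prod_coe_sort F (fun j => ∫ p, f j p ∂(μ j))

/-- the exponent -/
noncomputable def gexp (a e s : ℝ) : ℂ :=
  (a * Real.exp e : ℝ) * (Complex.exp (-(s * Complex.I)) - 1) + a * (Complex.exp (s * Complex.I) - 1)
    - s * Complex.I * (a * (1 - Real.exp e) : ℝ)

lemma aux_char (a : ℝ) (ha : 0 < a) (ε : ℕ → ℝ)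
    (η : Measure (ℕ → ℕ × ℕ)) 
    (hη : IsProductOf' η fun j => (pois (a * Real.exp (ε j))).prod (pois a)) (n : ℕ) (t β : ℝ) :
    ∫ z, Complex.exp (Complex.I * (t : ℂ) * ((β *
          ∑ j ∈ Finset.range n,
            (ε j * (((z j).2 : ℝ) - ((z j).1 : ℝ)) - a * ε j * (1 - Real.exp (ε j))) : ℝ) : ℂ)) ∂η
    = Complex.exp (∑ j ∈ Finset.range n, gexp a (ε j) (t * β * ε j)) := by
  have hsf : ∀ b, IsProbabilityMeasure (pois b) := by intro b; unfold pois; infer_instance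
  have h1 : ∀ z : ℕ → ℕ × ℕ, Complex.exp (Complex.I * (t : ℂ) * ((β *
          ∑ j ∈ Finset.range n,
            (ε j * (((z j).2 : ℝ) - ((z j).1 : ℝ)) - a * ε j * (1 - Real.exp (ε j))) : ℝ) : ℂ))
      = ∏ j ∈ Finset.range n, (fun (j : ℕ) (p : ℕ × ℕ) =>
        Complex.exp ((((t * β * ε j) * ((p.2 : ℝ) - p.1) : ℝ) : ℂ) * Complex.I) *
        Complex.exp (-((t * β * ε j : ℝ) * Complex.I * (a * (1 - Real.exp (ε j)) : ℝ)))) j (z j) := by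
    intro z
    simp only [← Complex.exp_add]
    rw [← Complex.exp_sum]
    congr 1
    push_cast
    rw [Finset.mul_sum, Finset.mul_sum]
    refine Finset.sum_congr rfl fun j _ => ?_
    ring
  rw [integral_congr_ae (Eventually.of_forall h1)]
  refine (aux_prod η _ hη (Finset.range n) (fun (j : ℕ) (p : ℕ × ℕ) =>
        Complex.exp ((((t * β * ε j) * ((p.2 : ℝ) - p.1) : ℝ) : ℂ) * Complex.I) *
        Complex.exp (-((t * β * ε j : ℝ) * Complex.I * (a * (1 - Real.exp (ε j)) : ℝ))))).trans ?_
  rw [Complex.exp_sum]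
  refine Finset.prod_congr rfl fun j _ => ?_
  rw [integral_mul_const, aux_pair a _ ha.le (by positivity), ← Complex.exp_add]
  rfl

lemma aux_R (s T : ℝ) (h : |s| ≤ T) :
    ‖Complex.exp (s * Complex.I) - (1 + s * Complex.I - s ^ 2 / 2)‖ ≤ |s| ^ 3 * Real.exp T := by
  have h1 := Complex.norm_exp_sub_sum_le_norm_mul_exp (s * Complex.I) 3
  have hn : ‖(s * Complex.I : ℂ)‖ = |s| := by simp
  rw [hn] at h1
  have h2 : ∑ m ∈ Finset.range 3, (s * Complex.I : ℂ) ^ m / (m.factorial : ℂ)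
      = 1 + s * Complex.I - s ^ 2 / 2 := by
    simp [Finset.sum_range_succ, mul_pow, Nat.factorial]
    ring
  rw [h2] at h1
  refine h1.trans ?_
  gcongr

lemma aux_g (a : ℝ) (ha : 0 < a) (e s T : ℝ) (h : |s| ≤ T) :
    ‖gexp a e s + (a * s ^ 2 : ℝ)‖ ≤
      a * s ^ 2 * ((Real.exp e + 1) * |s| * Real.exp T + |Real.exp e - 1|) := by
  have h1 := aux_R s T h
  have h2 := aux_R (-s) T (by simpa using h)
  have h3 : gexp a e s + (a * s ^ 2 : ℝ) =
      ((a * Real.exp e : ℝ) : ℂ) * (Complex.exp ((-s : ℝ) * Complex.I)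
        - (1 + (-s : ℝ) * Complex.I - (-s : ℝ) ^ 2 / 2))
      + (a : ℂ) * (Complex.exp (s * Complex.I) - (1 + s * Complex.I - s ^ 2 / 2))
      + ((- (a * s ^ 2 / 2 * (Real.exp e - 1)) : ℝ) : ℂ) := by
    unfold gexp
    push_cast
    ring_nf
  rw [h3]
  refine (norm_add₃_le).trans ?_
  rw [norm_mul, norm_mul, Complex.norm_real, Complex.norm_real, Complex.norm_real]
  simp only [Real.norm_eq_abs, abs_neg, abs_mul, abs_of_pos ha, Real.abs_exp] at *
  have h4 : |s ^ 2| = s ^ 2 := abs_of_nonneg (sq_nonneg s)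
  have h5 : |s| ^ 3 = s ^ 2 * |s| := by rw [pow_succ, sq_abs]
  rw [h5] at h1 h2
  rw [abs_div, abs_mul, h4, abs_of_pos ha, abs_two]
  calc _ ≤ a * Real.exp e * (s ^ 2 * |s| * Real.exp T) + a * (s ^ 2 * |s| * Real.exp T)
        + a * s ^ 2 / 2 * |Real.exp e - 1| := by gcongr
    _ ≤ _ := by
      have : 0 ≤ a * s ^ 2 * |Real.exp e - 1| := by positivity
      linarith

lemma aux_lim (a : ℝ) (ha : 0 < a) (ε : ℕ → ℝ)
    (hε0 : Tendsto ε atTop (nhds 0))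
    (hε2 : ¬ Summable fun j => ε j ^ 2) (t : ℝ) :
    Tendsto (fun n : ℕ => ∑ j ∈ Finset.range n, gexp a (ε j)
      (t * (Real.sqrt (∑ j ∈ Finset.range n, ε j ^ 2))⁻¹ * ε j)) atTop
      (nhds ((-a * t ^ 2 : ℝ) : ℂ)) := by
  have hS : Tendsto (fun n => ∑ j ∈ Finset.range n, ε j ^ 2) atTop atTop :=
    (not_summable_iff_tendsto_nat_atTop_of_nonneg (fun n => sq_nonneg _)).1 hε2
  obtain ⟨M, hM⟩ : ∃ M, ∀ j, |ε j| ≤ M := by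
    obtain ⟨M, hM⟩ := (Metric.isBounded_range_of_tendsto ε hε0).exists_norm_le
    exact ⟨M, fun j => hM _ ⟨j, rfl⟩⟩
  have hM0 : 0 ≤ M := (abs_nonneg _).trans (hM 0)
  have hces : Tendsto (fun n => (∑ j ∈ Finset.range n, ε j ^ 2 * |Real.exp (ε j) - 1|) /
      (∑ j ∈ Finset.range n, ε j ^ 2)) atTop (nhds 0) := by
    refine Asymptotics.IsLittleO.tendsto_div_nhds_zero ?_
    refine Asymptotics.IsLittleO.sum_range ?_ (fun n => sq_nonneg _) hS
    have h0 : Tendsto (fun j => |Real.exp (ε j) - 1|) atTop (nhds 0) := by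
      have hc : Continuous fun x : ℝ => |Real.exp x - 1| := by fun_prop
      simpa [Function.comp_def] using (hc.tendsto 0).comp hε0
    have := (Asymptotics.isBigO_refl (fun j => ε j ^ 2) atTop).mul_isLittleO
      ((Asymptotics.isLittleO_one_iff ℝ).2 h0)
    simpa using this
  have hβ : Tendsto (fun n => (Real.sqrt (∑ j ∈ Finset.range n, ε j ^ 2))⁻¹) atTop (nhds 0) :=
    tendsto_inv_atTop_zero.comp (Real.tendsto_sqrt_atTop.comp hS)
  rw [tendsto_iff_norm_sub_tendsto_zero]
  have hbd : Tendsto (fun n => a * t ^ 2 * ((Real.exp M + 1) *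
      (|t| * (Real.sqrt (∑ j ∈ Finset.range n, ε j ^ 2))⁻¹ * M) * Real.exp |t|
      + (∑ j ∈ Finset.range n, ε j ^ 2 * |Real.exp (ε j) - 1|) /
      (∑ j ∈ Finset.range n, ε j ^ 2))) atTop (nhds 0) := by
    have := ((((hβ.const_mul |t|).mul_const M).const_mul (Real.exp M + 1)).mul_const
      (Real.exp |t|)).add hces |>.const_mul (a * t ^ 2)
    simpa using this
  refine squeeze_zero' (Eventually.of_forall fun _ => norm_nonneg _) ?_ hbd
  filter_upwards [hS.eventually_gt_atTop 0] with n hn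
  set S := ∑ j ∈ Finset.range n, ε j ^ 2 with hSd
  set β := (Real.sqrt S)⁻¹ with hβd
  have hβ0 : 0 ≤ β := by positivity
  have hβ2 : β ^ 2 = S⁻¹ := by rw [hβd, inv_pow, Real.sq_sqrt hn.le]
  have hsum : ∑ j ∈ Finset.range n, a * (t * β * ε j) ^ 2 = a * t ^ 2 := by
    have : ∀ j, a * (t * β * ε j) ^ 2 = a * t ^ 2 * β ^ 2 * ε j ^ 2 := fun j => by ring
    simp_rw [this]
    rw [← Finset.mul_sum, ← hSd, hβ2]
    field_simp
  have hle : ∀ j ∈ Finset.range n, |t * β * ε j| ≤ |t| := by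
    intro j hj
    have h1 : ε j ^ 2 ≤ S := Finset.single_le_sum (f := fun j => ε j ^ 2) (fun i _ => sq_nonneg _) hj
    refine sq_le_sq.1 ?_
    have : (t * β * ε j) ^ 2 = t ^ 2 * (ε j ^ 2 / S) := by
      rw [mul_pow, mul_pow, hβ2]; ring
    rw [this]
    exact mul_le_of_le_one_right (sq_nonneg _) ((div_le_one hn).2 h1)
  have heq : ∑ j ∈ Finset.range n, gexp a (ε j) (t * β * ε j) - ((-a * t ^ 2 : ℝ) : ℂ)
      = ∑ j ∈ Finset.range n, (gexp a (ε j) (t * β * ε j) + (a * (t * β * ε j) ^ 2 : ℝ)) := by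
    rw [Finset.sum_add_distrib, ← Complex.ofReal_sum, hsum]
    push_cast; ring
  rw [heq]
  refine (norm_sum_le _ _).trans ?_
  calc _ ≤ ∑ j ∈ Finset.range n, (a * (t * β * ε j) ^ 2 * ((Real.exp M + 1) *
      (|t| * β * M) * Real.exp |t|) + a * t ^ 2 * (ε j ^ 2 * |Real.exp (ε j) - 1| / S)) := by
        refine Finset.sum_le_sum fun j hj => (aux_g a ha _ _ _ (hle j hj)).trans ?_
        have h1 : |t * β * ε j| ≤ |t| * β * M := by
          rw [abs_mul, abs_mul, abs_of_nonneg hβ0]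
          gcongr
          exact hM j
        have h2 : Real.exp (ε j) ≤ Real.exp M := Real.exp_le_exp.2 ((le_abs_self _).trans (hM j))
        rw [mul_add]
        refine add_le_add (by gcongr) (le_of_eq ?_)
        rw [mul_pow, mul_pow, hβ2]; ring
    _ = _ := by
        rw [Finset.sum_add_distrib, ← Finset.sum_mul, hsum, ← Finset.mul_sum, ← Finset.sum_div]
        ring

/-- On `Z = (ℕ×ℕ)^ℕ` with `η = ⊗_j (Pois(a e^{ε_j}) ⊗ Pois(a))`, let
`X_j(z) := ε_j (y_j - x_j)` for `z = ((x_j,y_j))_j`, `β_n := (Σ_{j<n} ε_j²)^{-1/2}` and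
`Y_n := β_n Σ_{j<n} (X_j - a ε_j (1 - e^{ε_j}))`.  If `ε_j → 0`, `Σ ε_j² = ∞` and
`Σ ε_j⁴ < ∞`, then the characteristic functions `E_η[e^{itY_n}]` converge to `e^{-a t²}`
for every `t ∈ ℝ`; consequently `(Y_n)` converges in distribution to a centered Gaussian
random variable of variance `2a`. -/
theorem stmt10 (a : ℝ) (ha : 0 < a) (ε : ℕ → ℝ)
    (hε0 : Tendsto ε atTop (nhds 0))
    (hε2 : ¬ Summable fun j => ε j ^ 2)
    (hε4 : Summable fun j => ε j ^ 4)
    (η : Measure (ℕ → ℕ × ℕ)) [IsProbabilityMeasure η]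
    (hη : IsProductOf' η fun j => (pois (a * Real.exp (ε j))).prod (pois a)) :
    (∀ t : ℝ, Tendsto
      (fun n : ℕ => ∫ z, Complex.exp (Complex.I * (t : ℂ) *
        (((Real.sqrt (∑ j ∈ Finset.range n, ε j ^ 2))⁻¹ *
          ∑ j ∈ Finset.range n,
            (ε j * (((z j).2 : ℝ) - ((z j).1 : ℝ)) - a * ε j * (1 - Real.exp (ε j))) : ℝ) : ℂ))
        ∂η)
      atTop (nhds (Complex.exp (((-a * t ^ 2 : ℝ) : ℂ))))) ∧
    (∀ f : BoundedContinuousFunction ℝ ℝ, Tendsto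
      (fun n : ℕ => ∫ z, f ((Real.sqrt (∑ j ∈ Finset.range n, ε j ^ 2))⁻¹ *
          ∑ j ∈ Finset.range n,
            (ε j * (((z j).2 : ℝ) - ((z j).1 : ℝ)) - a * ε j * (1 - Real.exp (ε j)))) ∂η)
      atTop (nhds (∫ x, f x ∂(gaussianReal 0 (2 * a).toNNReal)))) := by
  have hchar : ∀ t : ℝ, Tendsto
      (fun n : ℕ => ∫ z, Complex.exp (Complex.I * (t : ℂ) *
        (((Real.sqrt (∑ j ∈ Finset.range n, ε j ^ 2))⁻¹ *
          ∑ j ∈ Finset.range n,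
            (ε j * (((z j).2 : ℝ) - ((z j).1 : ℝ)) - a * ε j * (1 - Real.exp (ε j))) : ℝ) : ℂ))
        ∂η)
      atTop (nhds (Complex.exp (((-a * t ^ 2 : ℝ) : ℂ)))) := by
    intro t
    simp_rw [aux_char a ha ε η hη]
    exact (Complex.continuous_exp.tendsto _).comp (aux_lim a ha ε hε0 hε2 t)
  refine ⟨hchar, ?_⟩
  let Y : ℕ → (ℕ → ℕ × ℕ) → ℝ := fun n z => (Real.sqrt (∑ j ∈ Finset.range n, ε j ^ 2))⁻¹ *
          ∑ j ∈ Finset.range n,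
            (ε j * (((z j).2 : ℝ) - ((z j).1 : ℝ)) - a * ε j * (1 - Real.exp (ε j)))
  have hg : ∀ j : ℕ, Measurable fun z : ℕ → ℕ × ℕ => (((z j).2 : ℝ) - ((z j).1 : ℝ)) := fun j =>
    (Measurable.of_discrete (f := fun p : ℕ × ℕ => ((p.2 : ℝ) - (p.1 : ℝ)))).comp
      (measurable_pi_apply j)
  have hY : ∀ n, Measurable (Y n) := fun n =>
    (Finset.measurable_sum _ fun j _ => ((hg j).const_mul _).sub_const _).const_mul _
  let P : ℕ → ProbabilityMeasure ℝ := fun n =>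
    ⟨η.map (Y n), Measure.isProbabilityMeasure_map (hY n).aemeasurable⟩
  let P0 : ProbabilityMeasure ℝ := ⟨gaussianReal 0 (2 * a).toNNReal, inferInstance⟩
  have hP : Tendsto P atTop (nhds P0) := by
    refine ProbabilityMeasure.tendsto_of_tendsto_charFun fun t => ?_
    have h0 : charFun (P0 : Measure ℝ) t = Complex.exp (((-a * t ^ 2 : ℝ) : ℂ)) := by
      change charFun (gaussianReal 0 (2 * a).toNNReal) t = _
      rw [charFun_gaussianReal, Real.coe_toNNReal _ (by positivity)]
      congr 1
      push_cast
      ring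
    rw [h0]
    refine (hchar t).congr fun n => ?_
    change _ = charFun (η.map (Y n)) t
    rw [charFun_apply_real, integral_map (hY n).aemeasurable (by fun_prop)]
    congr 1
    ext z
    congr 1
    ring
  intro f
  have := (ProbabilityMeasure.tendsto_iff_forall_integral_tendsto.1 hP) f
  refine this.congr fun n => ?_
  change ∫ x, f x ∂(η.map (Y n)) = _
  rw [integral_map (hY n).aemeasurable f.continuous.aestronglyMeasurable]
end

section
/- Define ε : ℤ → ℝ by ε_k = −k^{-1/2} for integers k ≥ 2 and ε_k = 0 for k ≤ 1. Then for every n ≥ 1 the series Σ_{k∈ℤ} ( e^{3ε_k − 2ε_{k-n}} − e^{ε_k} ) converges absolutely, and there is a constant C > 0 such that for all integers n ≥ 2, | Σ_{k∈ℤ} ( e^{3ε_k − 2ε_{k-n}} − e^{ε_k} ) − 6 log n | ≤ C. -/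
/-- `eps k = -k^{-1/2}` for integers `k ≥ 2` and `eps k = 0` for `k ≤ 1`. -/
noncomputable def eps (k : ℤ) : ℝ := if 2 ≤ k then -(Real.sqrt k)⁻¹ else 0

theorem aux_hasSum_int {f : ℤ → ℝ} (hf : ∀ k < 2, f k = 0) {s : ℝ}
    (h : HasSum (fun j : ℕ => f ((j : ℤ) + 2)) s) : HasSum f s := by
  have hi : Function.Injective (fun j : ℕ => (j : ℤ) + 2) := by
    intro a b hab
    simpa using hab
  refine (hi.hasSum_iff ?_).1 h
  intro x hx
  apply hf
  by_contra hc
  apply hx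
  refine ⟨(x - 2).toNat, ?_⟩
  simp only
  omega

theorem aux_tele_one {f : ℤ → ℝ} (hf : ∀ k < 2, f k = 0)
    (hanti : ∀ k : ℤ, 2 ≤ k → f (k + 1) ≤ f k)
    (hlim : Filter.Tendsto (fun j : ℕ => f ((j : ℤ) + 2)) Filter.atTop (nhds 0)) :
    HasSum (fun k => f (k - 1) - f k) 0 := by
  apply aux_hasSum_int
  · intro k hk
    rw [hf k hk, hf (k - 1) (by omega), sub_zero]
  · rw [← hasSum_nat_add_iff' 1]
    have h1 : HasSum (fun j : ℕ => f ((j : ℤ) + 2) - f (((j + 1 : ℕ) : ℤ) + 2)) (f 2) := by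
      rw [hasSum_iff_tendsto_nat_of_nonneg]
      · have := hlim.const_sub (f 2)
        rw [sub_zero] at this
        refine this.congr ?_
        intro n
        rw [Finset.sum_range_sub' (fun j : ℕ => f ((j : ℤ) + 2))]
        simp
      · intro j
        have := hanti ((j : ℤ) + 2) (by omega)
        push_cast
        rw [show (j : ℤ) + 1 + 2 = (j : ℤ) + 2 + 1 by ring]
        linarith
    have e1 : (fun j : ℕ => f (((j + 1 : ℕ) : ℤ) + 2 - 1) - f (((j + 1 : ℕ) : ℤ) + 2))
        = (fun j : ℕ => f ((j : ℤ) + 2) - f (((j + 1 : ℕ) : ℤ) + 2)) := by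
      funext j
      rw [show ((j + 1 : ℕ) : ℤ) + 2 - 1 = (j : ℤ) + 2 by push_cast; ring]
    have e2 : 0 - ∑ i ∈ Finset.range 1, (f ((i : ℤ) + 2 - 1) - f ((i : ℤ) + 2)) = f 2 := by
      simp [hf 1 (by norm_num)]
    rw [e1, e2]
    exact h1

theorem aux_tele {f : ℤ → ℝ} (hf : ∀ k < 2, f k = 0)
    (hanti : ∀ k : ℤ, 2 ≤ k → f (k + 1) ≤ f k)
    (hlim : Filter.Tendsto (fun j : ℕ => f ((j : ℤ) + 2)) Filter.atTop (nhds 0)) (n : ℕ) :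
    HasSum (fun k => f (k - (n : ℤ)) - f k) 0 := by
  induction n with
  | zero => simp [hasSum_zero]
  | succ n ih =>
    have h1 := aux_tele_one hf hanti hlim
    have h2 := (Equiv.hasSum_iff (Equiv.subRight (1 : ℤ))).2 ih
    have h3 := h2.add h1
    rw [add_zero] at h3
    convert h3 using 1
    funext k
    simp only [Function.comp, Equiv.subRight_apply]
    rw [show k - ((n + 1 : ℕ) : ℤ) = k - 1 - n by push_cast; ring]
    ring

noncomputable def aa (k : ℤ) : ℝ := -eps k

theorem aa_lt {k : ℤ} (hk : k < 2) : aa k = 0 := by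
  simp [aa, eps, not_le.2 hk]

theorem aa_ge {k : ℤ} (hk : 2 ≤ k) : aa k = (Real.sqrt k)⁻¹ := by
  simp [aa, eps, hk]

theorem aa_nonneg (k : ℤ) : 0 ≤ aa k := by
  by_cases hk : 2 ≤ k
  · rw [aa_ge hk]; positivity
  · rw [aa_lt (not_le.1 hk)]

theorem aa_mono {k l : ℤ} (hk : 2 ≤ k) (hkl : k ≤ l) : aa l ≤ aa k := by
  rw [aa_ge hk, aa_ge (hk.trans hkl)]
  have : (0 : ℝ) < k := by exact_mod_cast (by omega : 0 < k)
  have h2 : (k : ℝ) ≤ l := by exact_mod_cast hkl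
  gcongr

theorem aa_le_one (k : ℤ) : aa k ≤ 1 := by
  by_cases hk : 2 ≤ k
  · rw [aa_ge hk]
    apply inv_le_one_of_one_le₀
    rw [Real.one_le_sqrt]
    exact_mod_cast (by omega : 1 ≤ k)
  · rw [aa_lt (not_le.1 hk)]; norm_num

theorem aa_sq {k : ℤ} (hk : 2 ≤ k) : aa k ^ 2 = (k : ℝ)⁻¹ := by
  rw [aa_ge hk, inv_pow, Real.sq_sqrt]
  exact_mod_cast (by omega : 0 ≤ k)

theorem aa_lim : Filter.Tendsto (fun j : ℕ => aa ((j : ℤ) + 2)) Filter.atTop (nhds 0) := by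
  have h : Filter.Tendsto (fun j : ℕ => (Real.sqrt ((j + 2 : ℕ) : ℝ))⁻¹) Filter.atTop (nhds 0) :=
    (Real.tendsto_sqrt_atTop.comp (tendsto_natCast_atTop_atTop.comp
      (Filter.tendsto_add_atTop_nat 2))).inv_tendsto_atTop
  refine h.congr ?_
  intro j
  rw [aa_ge (by omega)]
  push_cast
  rfl

theorem aa_tele (n : ℕ) : HasSum (fun k => aa (k - (n : ℤ)) - aa k) 0 :=
  aux_tele (fun _ hk => aa_lt hk) (fun _ hk => aa_mono hk (by omega)) aa_lim n

theorem aa_tele_sq (n : ℕ) : HasSum (fun k => aa (k - (n : ℤ)) ^ 2 - aa k ^ 2) 0 := by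
  refine aux_tele (f := fun k => aa k ^ 2) (fun _ hk => ?_) (fun k hk => ?_) ?_ n
  · simp [aa_lt hk]
  · exact pow_le_pow_left₀ (aa_nonneg _) (aa_mono hk (by omega)) 2
  · simpa using aa_lim.pow 2

theorem aa_cube : Summable (fun k => aa k ^ 3) := by
  have h : Summable (fun j : ℕ => aa ((j : ℤ) + 2) ^ 3) := by
    have h0 : Summable (fun n : ℕ => 1 / (n : ℝ) ^ (3 / 2 : ℝ)) :=
      Real.summable_one_div_nat_rpow.2 (by norm_num)
    refine ((summable_nat_add_iff 2).2 h0).congr ?_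
    intro j
    rw [aa_ge (by omega)]
    push_cast
    rw [inv_pow, Real.sqrt_eq_rpow, ← Real.rpow_natCast, ← Real.rpow_mul (by positivity)]
    norm_num
  obtain ⟨s, hs⟩ := h
  exact ⟨s, aux_hasSum_int (f := fun k => aa k ^ 3) (fun k hk => by simp [aa_lt hk]) hs⟩

theorem aa_cut (p : ℕ) (hp : p ≠ 0) (n : ℕ) :
    HasSum (fun k : ℤ => if k ≤ n + 1 then aa k ^ p else 0)
      (∑ j ∈ Finset.range n, aa ((j : ℤ) + 2) ^ p) := by
  apply aux_hasSum_int
  · intro k hk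
    simp [aa_lt hk, hp]
  · have : ∑ j ∈ Finset.range n, aa ((j : ℤ) + 2) ^ p = ∑ j ∈ Finset.range n,
        (if (j : ℤ) + 2 ≤ n + 1 then aa ((j : ℤ) + 2) ^ p else 0) := by
      refine Finset.sum_congr rfl fun j hj => ?_
      rw [Finset.mem_range] at hj
      rw [if_pos (by omega)]
    rw [this]
    apply hasSum_sum_of_ne_finset_zero
    intro j hj
    rw [Finset.mem_range] at hj
    rw [if_neg (by omega)]

theorem aa_sum_le (n : ℕ) :
    ∑ j ∈ Finset.range n, aa ((j : ℤ) + 2) ≤ 2 * Real.sqrt n := by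
  induction n with
  | zero => simp
  | succ n ih =>
    rw [Finset.sum_range_succ]
    have h1 : aa ((n : ℤ) + 2) ≤ (Real.sqrt (n + 1))⁻¹ := by
      rw [aa_ge (by omega)]
      push_cast
      gcongr
      norm_num
    have h2 : (Real.sqrt (n + 1))⁻¹ ≤ 2 * Real.sqrt (n + 1) - 2 * Real.sqrt n := by
      have hx : 0 < Real.sqrt ((n : ℝ) + 1) := by positivity
      have e1 := Real.sq_sqrt (show (0 : ℝ) ≤ n + 1 by positivity)
      have e2 := Real.sq_sqrt (show (0 : ℝ) ≤ n by positivity)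
      rw [inv_le_iff_one_le_mul₀ hx]
      nlinarith [sq_nonneg (Real.sqrt ((n : ℝ) + 1) - Real.sqrt n)]
    push_cast
    linarith

theorem aa_sum_sq (n : ℕ) :
    ∑ j ∈ Finset.range n, aa ((j : ℤ) + 2) ^ 2 = (harmonic (n + 1) : ℝ) - 1 := by
  induction n with
  | zero => simp [harmonic_succ]
  | succ n ih =>
    rw [Finset.sum_range_succ, ih, harmonic_succ (n + 1), aa_sq (by omega)]
    push_cast
    ring

theorem aa_sum_sq_log (n : ℕ) (hn : 1 ≤ n) :
    |∑ j ∈ Finset.range n, aa ((j : ℤ) + 2) ^ 2 - Real.log n| ≤ 1 := by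
  rw [aa_sum_sq]
  have h1 := log_add_one_le_harmonic (n + 1)
  have h2 := harmonic_le_one_add_log (n + 1)
  have hn' : (1 : ℝ) ≤ n := by exact_mod_cast hn
  push_cast at h1 h2
  have h3 : Real.log n ≤ Real.log (n + 1 + 1) := Real.log_le_log (by positivity) (by linarith)
  have h4 : Real.log (n + 1) ≤ Real.log n + 1 := by
    have : Real.log (n + 1) - Real.log n = Real.log ((n + 1) / n) := by
      rw [Real.log_div (by positivity) (by positivity)]
    have h5 := Real.log_le_sub_one_of_pos (show (0 : ℝ) < (n + 1) / n by positivity)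
    have h6 : ((n : ℝ) + 1) / n ≤ 2 := by
      rw [div_le_iff₀ (by positivity)]; linarith
    linarith
  rw [abs_le]
  constructor <;> linarith

theorem exp3 (x : ℝ) (hx : |x| ≤ 3) :
    |Real.exp x - (1 + x + x ^ 2 / 2)| ≤ Real.exp 3 * |x| ^ 3 := by
  have h := Complex.norm_exp_sub_sum_le_norm_mul_exp (x : ℂ) 3
  have e : Complex.exp (x : ℂ) - ∑ m ∈ Finset.range 3, (x : ℂ) ^ m / (m.factorial : ℂ)
      = ((Real.exp x - (1 + x + x ^ 2 / 2) : ℝ) : ℂ) := by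
    simp [Finset.sum_range_succ, Nat.factorial]
  rw [e, Complex.norm_real, Complex.norm_real, Real.norm_eq_abs, Real.norm_eq_abs] at h
  have h2 : Real.exp |x| ≤ Real.exp 3 := Real.exp_le_exp.2 hx
  calc _ ≤ _ := h
    _ ≤ |x| ^ 3 * Real.exp 3 := by gcongr
    _ = _ := mul_comm _ _

theorem rem_bound (a b : ℝ) (ha : 0 ≤ a) (hb : 0 ≤ b) (ha1 : a ≤ 1) (hb1 : b ≤ 1) :
    |Real.exp (-3 * a + 2 * b) - Real.exp (-a)
      - (2 * (b - a) + 2 * (b ^ 2 - a ^ 2) + 6 * (a * (a - b)))|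
      ≤ Real.exp 3 * 126 * (a ^ 3 + b ^ 3) := by
  have h1 := exp3 (-3 * a + 2 * b) (by rw [abs_le]; constructor <;> linarith)
  have h2 := exp3 (-a) (by rw [abs_le]; constructor <;> linarith)
  have e : Real.exp (-3 * a + 2 * b) - Real.exp (-a)
      - (2 * (b - a) + 2 * (b ^ 2 - a ^ 2) + 6 * (a * (a - b)))
      = (Real.exp (-3 * a + 2 * b) - (1 + (-3 * a + 2 * b) + (-3 * a + 2 * b) ^ 2 / 2))
        - (Real.exp (-a) - (1 + -a + (-a) ^ 2 / 2)) := by ring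
  rw [e]
  have h3 : |-3 * a + 2 * b| ^ 3 ≤ 125 * (a ^ 3 + b ^ 3) := by
    have : |-3 * a + 2 * b| ≤ 5 * max a b := by
      have := le_max_left a b
      have := le_max_right a b
      rw [abs_le]; constructor <;> linarith
    calc |-3 * a + 2 * b| ^ 3 ≤ (5 * max a b) ^ 3 := by gcongr
      _ = 125 * (max a b) ^ 3 := by ring
      _ ≤ _ := by
        have := pow_nonneg ha 3
        have := pow_nonneg hb 3
        rcases max_cases a b with h | h <;> rw [h.1] <;> linarith
  have h4 : |-a| ^ 3 ≤ a ^ 3 + b ^ 3 := by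
    rw [abs_neg, abs_of_nonneg ha]
    have := pow_nonneg hb 3
    linarith
  have hE := Real.exp_pos 3
  calc _ ≤ _ := abs_sub _ _
    _ ≤ Real.exp 3 * (125 * (a ^ 3 + b ^ 3)) + Real.exp 3 * (a ^ 3 + b ^ 3) := by
      refine add_le_add (h1.trans ?_) (h2.trans ?_) <;> gcongr
    _ = _ := by ring

theorem aux_bound {f g : ℤ → ℝ} {s : ℝ} (hg : HasSum g s) (h : ∀ k, |f k| ≤ g k) :
    ∃ t, HasSum f t ∧ |t| ≤ s := by
  have hf : Summable f := Summable.of_norm_bounded hg.summable h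
  refine ⟨_, hf.hasSum, ?_⟩
  exact tsum_of_norm_bounded (f := f) hg h

theorem main_sum (n : ℕ) (hn : 1 ≤ n) :
    ∃ t, HasSum (fun k : ℤ => Real.exp (3 * eps k - 2 * eps (k - (n : ℤ))) - Real.exp (eps k)) t ∧
      |t - 6 * Real.log n| ≤ 18 + Real.exp 3 * 126 * (2 * ∑' k, aa k ^ 3) := by
  have hn' : (0 : ℝ) < n := by exact_mod_cast hn
  have hs : 0 < Real.sqrt n := Real.sqrt_pos.2 hn'
  -- remainder
  obtain ⟨r, hr, hrb⟩ : ∃ r, HasSum (fun k : ℤ =>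
      Real.exp (-3 * aa k + 2 * aa (k - (n : ℤ))) - Real.exp (-aa k)
      - (2 * (aa (k - (n : ℤ)) - aa k) + 2 * (aa (k - (n : ℤ)) ^ 2 - aa k ^ 2)
        + 6 * (aa k * (aa k - aa (k - (n : ℤ)))))) r ∧
      |r| ≤ Real.exp 3 * 126 * (2 * ∑' k, aa k ^ 3) := by
    have h1 := aa_cube.hasSum
    have h2 := (Equiv.hasSum_iff (Equiv.subRight (n : ℤ))).2 h1
    have h3 := (h1.add h2).mul_left (Real.exp 3 * 126)
    rw [← two_mul] at h3
    exact aux_bound h3 fun k => rem_bound _ _ (aa_nonneg _) (aa_nonneg _) (aa_le_one _)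
      (aa_le_one _)
  obtain ⟨w, hw, hwb⟩ : ∃ w, HasSum (fun k : ℤ => aa k * (aa k - aa (k - (n : ℤ)))
      - (if k ≤ n + 1 then aa k ^ 2 else 0)) w ∧ |w| ≤ (Real.sqrt n)⁻¹ *
        (0 + ∑ j ∈ Finset.range n, aa ((j : ℤ) + 2) ^ 1) := by
    refine aux_bound (((aa_tele n).add (aa_cut 1 one_ne_zero n)).mul_left _) fun k => ?_
    by_cases hk : k ≤ n + 1
    · rw [aa_lt (show k - (n : ℤ) < 2 by omega), if_pos hk, if_pos hk]
      simp [sq]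
    · rw [if_neg hk, if_neg hk, sub_zero, add_zero, abs_mul, abs_of_nonneg (aa_nonneg _),
        abs_sub_comm, abs_of_nonneg]
      · have hm := aa_mono (show 2 ≤ k - (n : ℤ) by omega) (show k - (n : ℤ) ≤ k by omega)
        refine mul_le_mul_of_nonneg_right ?_ (by linarith)
        rw [aa_ge (by omega)]
        have : (n : ℝ) ≤ k := by exact_mod_cast (by omega : (n : ℤ) ≤ k)
        gcongr
      · have hm := aa_mono (show 2 ≤ k - (n : ℤ) by omega) (show k - (n : ℤ) ≤ k by omega)
        linarith
  have hw2 : |w| ≤ 2 := by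
    refine hwb.trans ?_
    simp only [pow_one, zero_add]
    rw [inv_mul_le_iff₀ hs]
    linarith [aa_sum_le n]
  have hc := aa_cut 2 two_ne_zero n
  have hl := aa_sum_sq_log n hn
  have hT := (((hr.add ((aa_tele n).mul_left 2)).add ((aa_tele_sq n).mul_left 2)).add
    ((hw.add hc).mul_left 6))
  refine ⟨r + 2 * 0 + 2 * 0 + 6 * (w + ∑ j ∈ Finset.range n, aa ((j : ℤ) + 2) ^ 2), ?_, ?_⟩
  · convert hT using 1
    funext k
    simp only [aa]
    rw [show -3 * -eps k + 2 * -eps (k - (n : ℤ)) = 3 * eps k - 2 * eps (k - (n : ℤ)) by ring,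
      neg_neg]
    ring
  · have h1 := abs_le.1 hrb
    have h2 := abs_le.1 hw2
    have h3 := abs_le.1 hl
    rw [abs_le]
    constructor <;> linarith [h1.1, h1.2, h2.1, h2.2, h3.1, h3.2]

theorem stmt13 :
    (∀ n : ℕ, 1 ≤ n → Summable fun k : ℤ =>
      |Real.exp (3 * eps k - 2 * eps (k - (n : ℤ))) - Real.exp (eps k)|) ∧
    ∃ C : ℝ, 0 < C ∧ ∀ n : ℕ, 2 ≤ n →
      |(∑' k : ℤ, (Real.exp (3 * eps k - 2 * eps (k - (n : ℤ))) - Real.exp (eps k)))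
        - 6 * Real.log n| ≤ C := by
  refine ⟨fun n hn => ?_, 18 + Real.exp 3 * 126 * (2 * ∑' k, aa k ^ 3), ?_, fun n hn => ?_⟩
  · obtain ⟨t, ht, -⟩ := main_sum n hn
    exact ht.summable.abs
  · have : 0 ≤ ∑' k, aa k ^ 3 := tsum_nonneg fun k => pow_nonneg (aa_nonneg k) 3
    positivity
  · obtain ⟨t, ht, hb⟩ := main_sum n (by omega)
    rw [ht.tsum_eq]
    exact hb
end

section
/- Define ε : ℤ → ℝ by ε_k = −k^{-1/2} for integers k ≥ 2 and ε_k = 0 for k ≤ 1, and set a_n := a e^{ε_n} for n ∈ ℤ. If 0 < a < 1/6, then the shift σ on (ℕ^ℤ, η) with η = ⊗_{n∈ℤ} Pois(a e^{ε_n}) is nonsingular and conservative. -/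
open MeasureTheory ProbabilityTheory Filter

open scoped symmDiff

lemma aux_pt (a b : ℝ) (hb : 0 < b) (n : ℕ) :
    (Real.exp (-a) * a ^ n / n.factorial) ^ 2 =
      Real.exp ((a - b) ^ 2 / b) * (Real.exp (-(a ^ 2 / b)) * (a ^ 2 / b) ^ n / n.factorial) *
        (Real.exp (-b) * b ^ n / n.factorial) := by
  have h1 : Real.exp (-a) ^ 2 = Real.exp ((a - b) ^ 2 / b) * Real.exp (-(a ^ 2 / b)) * Real.exp (-b) := by
    rw [← Real.exp_add, ← Real.exp_add, ← Real.exp_nat_mul]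
    congr 1
    field_simp
    push_cast
    ring
  have h2 : (a ^ n) ^ 2 = (a ^ 2 / b) ^ n * b ^ n := by
    rw [← mul_pow, div_mul_cancel₀ _ hb.ne']; ring
  rw [div_pow, mul_pow, h1, h2]
  field_simp

lemma pois_real (a : ℝ) (ha : 0 ≤ a) (n : ℕ) :
    (pois a).real {n} = Real.exp (-a) * a ^ n / n.factorial := by
  rw [pois, poissonMeasure_real_singleton, Real.coe_toNNReal _ ha]

instance (a : ℝ) : IsProbabilityMeasure (pois a) := by unfold pois; infer_instance

lemma measure_le_count {α : Type*} [MeasurableSpace α] [Countable α] [MeasurableSingletonClass α]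
    {μ ν : Measure α} (h : ∀ x, μ {x} ≤ ν {x}) (s : Set α) : μ s ≤ ν s := by
  rw [← μ.tsum_indicator_apply_singleton s (Set.to_countable s).measurableSet,
    ← ν.tsum_indicator_apply_singleton s (Set.to_countable s).measurableSet]
  exact ENNReal.tsum_le_tsum fun x => Set.indicator_le_indicator (h x)

lemma map_restrict_eq (η : Measure (ℤ → ℕ)) [IsProbabilityMeasure η] (a : ℤ → ℝ)
    (hη : IsProductOf η fun n => pois (a n)) (F : Finset ℤ) :
    η.map F.restrict = Measure.pi (fun i : F => pois (a i)) := by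
  refine Measure.ext_of_singleton fun v => ?_
  rw [Measure.map_apply (by fun_prop) (measurableSet_singleton _), Measure.pi_singleton]
  have := hη F (fun i => if h : i ∈ F then v ⟨i, h⟩ else 0)
  rw [← Finset.prod_coe_sort] at this
  simp only [Finset.coe_mem, dite_true] at this
  rw [← this]
  congr 1
  ext y
  simp only [Set.mem_preimage, Set.mem_singleton_iff, Set.mem_ofPred_eq, funext_iff, Subtype.forall,
    Finset.restrict]
  refine forall₂_congr fun i hi => by simp [hi]

lemma cyl_bound (P Q : Measure (ℤ → ℕ)) [IsProbabilityMeasure P] [IsProbabilityMeasure Q]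
    (a b : ℤ → ℝ) (ha : ∀ n, 0 < a n) (hb : ∀ n, 0 < b n)
    (hP : IsProductOf P fun n => pois (a n)) (hQ : IsProductOf Q fun n => pois (b n))
    (K : ℝ) (hK : ∀ F : Finset ℤ, Real.exp (∑ i ∈ F, (a i - b i) ^ 2 / b i) ≤ K)
    (t : ℝ) (ht : 0 < t) (C : Set (ℤ → ℕ)) (hC : C ∈ measurableCylinders fun _ : ℤ => ℕ) :
    2 * P.real C ≤ t * K + Q.real C / t := by
  obtain ⟨F, S, hS, rfl⟩ := (mem_measurableCylinders _).1 hC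
  have hK0 : 0 ≤ K := (Real.exp_pos _).le.trans (hK ∅)
  have e1 : P.real (cylinder F S) = (Measure.pi (fun i : F => pois (a i))).real S := by
    rw [← map_restrict_eq P a hP F, map_measureReal_apply (by fun_prop) hS]; rfl
  have e2 : Q.real (cylinder F S) = (Measure.pi (fun i : F => pois (b i))).real S := by
    rw [← map_restrict_eq Q b hQ F, map_measureReal_apply (by fun_prop) hS]; rfl
  rw [e1, e2]
  set p := Measure.pi (fun i : F => pois (a i))
  set q := Measure.pi (fun i : F => pois (b i))
  set r := Measure.pi (fun i : F => pois (a i ^ 2 / b i)) with hr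
  have hpt : ∀ v, 2 * p.real {v} ≤ t * K * r.real {v} + t⁻¹ * q.real {v} := by
    intro v
    have h0 : p.real {v} ^ 2 = Real.exp (∑ i ∈ F, (a i - b i) ^ 2 / b i) * r.real {v} * q.real {v} := by
      simp only [p, q, r, Measure.real, Measure.pi_singleton, ENNReal.toReal_prod]
      rw [Real.exp_sum, ← Finset.prod_coe_sort F, ← Finset.prod_mul_distrib, ← Finset.prod_mul_distrib, ← Finset.prod_pow]
      refine Finset.prod_congr rfl fun i _ => ?_
      have := aux_pt (a i) (b i) (hb i) (v i)
      rw [← pois_real _ (ha i).le, ← pois_real _ (hb i).le,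
        ← pois_real _ (div_nonneg (sq_nonneg _) (hb i).le)] at this
      exact this
    have hr0 : 0 ≤ r.real {v} := measureReal_nonneg
    have hq0 : 0 ≤ q.real {v} := measureReal_nonneg
    have h1 : p.real {v} ^ 2 ≤ K * r.real {v} * q.real {v} := by
      rw [h0]; gcongr; exact hK F
    refine le_of_sq_le_sq ?_ (by positivity)
    have : (t * K * r.real {v}) * (t⁻¹ * q.real {v}) = K * r.real {v} * q.real {v} := by
      field_simp
    nlinarith [sq_nonneg (t * K * r.real {v} - t⁻¹ * q.real {v})]
  have hm := measure_le_count (μ := (2 : NNReal) • p)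
    (ν := (t * K).toNNReal • r + (t⁻¹).toNNReal • q) (fun v => by
      rw [← ENNReal.toReal_le_toReal (by finiteness) (by finiteness)]
      have := hpt v
      change ((2 : NNReal) • p).real {v} ≤ ((t * K).toNNReal • r + (t⁻¹).toNNReal • q).real {v}
      rw [measureReal_add_apply, measureReal_nnreal_smul_apply, measureReal_nnreal_smul_apply,
        measureReal_nnreal_smul_apply, Real.coe_toNNReal _ (by positivity),
        Real.coe_toNNReal _ (by positivity)]
      exact this) S
  rw [← ENNReal.toReal_le_toReal (by finiteness) (by finiteness)] at hm
  change ((2 : NNReal) • p).real S ≤ ((t * K).toNNReal • r + (t⁻¹).toNNReal • q).real S at hm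
  rw [measureReal_add_apply, measureReal_nnreal_smul_apply, measureReal_nnreal_smul_apply,
        measureReal_nnreal_smul_apply, Real.coe_toNNReal _ (by positivity),
        Real.coe_toNNReal _ (by positivity)] at hm
  have hr1 : r.real S ≤ 1 := measureReal_le_one
  have : t * K * r.real S ≤ t * K := mul_le_of_le_one_right (by positivity) hr1
  rw [div_eq_inv_mul]
  norm_num at hm ⊢
  linarith

lemma key (P Q : Measure (ℤ → ℕ)) [IsProbabilityMeasure P] [IsProbabilityMeasure Q]
    (a b : ℤ → ℝ) (ha : ∀ n, 0 < a n) (hb : ∀ n, 0 < b n)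
    (hP : IsProductOf P fun n => pois (a n)) (hQ : IsProductOf Q fun n => pois (b n))
    (K : ℝ) (hK : ∀ F : Finset ℤ, Real.exp (∑ i ∈ F, (a i - b i) ^ 2 / b i) ≤ K)
    (B : Set (ℤ → ℕ)) (hB : MeasurableSet B) :
    P.real B ^ 2 ≤ K * Q.real B := by
  have hK0 : 0 < K := (Real.exp_pos _).trans_le (hK ∅)
  have main : ∀ t : ℝ, 0 < t → 2 * P.real B ≤ t * K + Q.real B / t := by
    intro t ht
    have hε : ∀ ε : ℝ, 0 < ε → 2 * P.real B ≤ t * K + Q.real B / t + (2 + 1 / t) * ε := by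
      intro ε hε
      obtain ⟨C, hC, hCB⟩ := exists_measure_symmDiff_lt_of_generateFrom_isSetRing (μ := P + Q)
        (C := measurableCylinders fun _ : ℤ => ℕ) isSetRing_measurableCylinders
        ⟨{Set.univ}, by simp, by simpa using univ_mem_measurableCylinders (fun _ : ℤ => ℕ), by simp⟩
        generateFrom_measurableCylinders.symm hB (ENNReal.ofReal_pos.2 hε)
      have hreal : (P + Q).real (C ∆ B) < ε := by
        exact (ENNReal.lt_ofReal_iff_toReal_lt (by finiteness)).1 hCB
      rw [measureReal_add_apply] at hreal
      have hPn : 0 ≤ P.real (C ∆ B) := measureReal_nonneg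
      have hQn : 0 ≤ Q.real (C ∆ B) := measureReal_nonneg
      have s1 : B ⊆ C ∪ C ∆ B := by
        intro x hx; by_cases h : x ∈ C <;> simp [Set.mem_symmDiff, h, hx]
      have s2 : C ⊆ B ∪ C ∆ B := by
        intro x hx; by_cases h : x ∈ B <;> simp [Set.mem_symmDiff, h, hx]
      have h1 : P.real B ≤ P.real C + P.real (C ∆ B) :=
        (measureReal_mono s1).trans (measureReal_union_le _ _)
      have h2 : Q.real C ≤ Q.real B + Q.real (C ∆ B) :=
        (measureReal_mono s2).trans (measureReal_union_le _ _)
      have h3 := cyl_bound P Q a b ha hb hP hQ K hK t ht C hC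
      have h4 : Q.real C / t ≤ (Q.real B + ε) / t := by gcongr; linarith
      rw [add_div] at h4
      have : (2 + 1 / t) * ε = 2 * ε + ε / t := by ring
      linarith
    refine le_of_forall_pos_le_add fun δ hδ => ?_
    have := hε (δ / (2 + 1 / t)) (by positivity)
    rwa [mul_div_cancel₀ _ (by positivity)] at this
  have hP0 : 0 ≤ P.real B := measureReal_nonneg
  have hQ0 : 0 ≤ Q.real B := measureReal_nonneg
  rcases hP0.eq_or_lt with h | h
  · rw [← h]; simp; positivity
  · have := main (P.real B / K) (by positivity)
    rw [div_mul_cancel₀ _ hK0.ne'] at this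
    have h2 : P.real B ≤ Q.real B / (P.real B / K) := by linarith
    rw [le_div_iff₀ (by positivity)] at h2
    have : P.real B * (P.real B / K) * K = P.real B ^ 2 := by field_simp
    nlinarith

lemma shift_pow_apply (n : ℕ) (y : ℤ → ℕ) (i : ℤ) : (shift ^ n) y i = y (i + n) := by
  induction n generalizing y i with
  | zero => simp
  | succ n ih =>
    rw [pow_succ, Equiv.Perm.mul_apply, ih]
    change y (i + n + 1) = _
    push_cast
    congr 1
    ring

lemma meas_shift (n : ℕ) : Measurable ⇑(shift ^ n) := by
  refine measurable_pi_lambda _ fun i => ?_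
  simp_rw [shift_pow_apply]
  fun_prop

lemma prod_shift (η : Measure (ℤ → ℕ)) (μ : ℤ → Measure ℕ) (h : IsProductOf η μ) (n : ℕ) :
    IsProductOf (η.map ⇑(shift ^ n)) (fun i => μ (i + n)) := by
  intro F v
  have hm : MeasurableSet {y : ℤ → ℕ | ∀ i ∈ F, y i = v i} := by
    have : {y : ℤ → ℕ | ∀ i ∈ F, y i = v i} = ⋂ i ∈ F, (fun y : ℤ → ℕ => y i) ⁻¹' {v i} := by
      ext; simp
    rw [this]
    exact Finset.measurableSet_biInter _ fun i _ => measurable_pi_apply i (measurableSet_singleton _)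
  rw [Measure.map_apply (meas_shift n) hm]
  have := h (F.map (addRightEmbedding (n : ℤ))) (fun i => v (i - n))
  simp only [Finset.mem_map, Finset.prod_map, addRightEmbedding_apply, forall_exists_index, and_imp,
    forall_apply_eq_imp_iff₂, add_sub_cancel_right] at this
  rw [← this]
  congr 1
  ext y
  simp [shift_pow_apply]

/-- squares of eps -/
lemma eps_sq (k : ℤ) (hk : 2 ≤ k) : eps k ^ 2 = 1 / (k : ℝ) := by
  have : (0 : ℝ) ≤ k := by exact_mod_cast (by lia : (0 : ℤ) ≤ k)
  rw [eps, if_pos hk, neg_sq, inv_pow, Real.sq_sqrt this, one_div]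

lemma eps_one (k : ℤ) (hk : k ≤ 1) : eps k = 0 := by rw [eps, if_neg (by lia)]

lemma eps_nonpos (k : ℤ) : eps k ≤ 0 := by
  unfold eps; split_ifs
  · simp
  · rfl

lemma eps_ge (k : ℤ) : -1 ≤ eps k := by
  by_cases hk : 2 ≤ k
  · have h := eps_sq k hk
    have : (2 : ℝ) ≤ k := by exact_mod_cast hk
    have h2 : 1 / (k : ℝ) ≤ 1 := by rw [div_le_one (by linarith)]; linarith
    nlinarith
  · rw [eps_one k (by lia)]; norm_num

lemma sq_sub_le (i : ℤ) (n : ℕ) : (eps i - eps (i + n)) ^ 2 ≤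
    if i ≤ 1 then eps (i + n) ^ 2 else eps i ^ 2 - eps (i + n) ^ 2 := by
  split_ifs with h
  · rw [eps_one i h]; simp
  · have h1 := eps_sq i (by lia)
    have h2 := eps_sq (i + n) (by lia)
    have h3 := eps_nonpos i
    have h4 := eps_nonpos (i + n)
    have hi : (0 : ℝ) < i := by exact_mod_cast (by lia : (0 : ℤ) < i)
    have : eps (i + n) ^ 2 ≤ eps i ^ 2 := by
      rw [h1, h2]; push_cast
      exact one_div_le_one_div_of_le hi (by simp)
    have : eps i ≤ eps (i + n) := by
      by_contra hc; push Not at hc; nlinarith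
    nlinarith

lemma sumA (M n : ℕ) : ∑ j ∈ Finset.range M, eps (1 - j + n) ^ 2 ≤
    ∑ j ∈ Finset.range n, eps (2 + j) ^ 2 := by
  induction n with
  | zero => 
    refine (Finset.sum_eq_zero fun j _ => ?_).le
    rw [eps_one _ (by simp)]; simp
  | succ n ih =>
    rw [Finset.sum_range_succ]
    have : ∑ j ∈ Finset.range M, eps (1 - j + (n + 1 : ℕ)) ^ 2 - ∑ j ∈ Finset.range M, eps (1 - j + n) ^ 2
       = eps (2 + n) ^ 2 - eps (2 - M + n) ^ 2 := by
      rw [← Finset.sum_sub_distrib]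
      have := Finset.sum_range_sub' (fun j : ℕ => eps (2 - j + n) ^ 2) M
      simp only [Nat.cast_zero, sub_zero] at this
      rw [← this]
      refine Finset.sum_congr rfl fun j _ => ?_
      push_cast
      ring_nf
    nlinarith [sq_nonneg (eps (2 - M + n))]

lemma sumB (M n : ℕ) : ∑ j ∈ Finset.range M, (eps (2 + j) ^ 2 - eps (2 + j + n) ^ 2) ≤
    ∑ j ∈ Finset.range n, eps (2 + j) ^ 2 := by
  induction n with
  | zero => simp
  | succ n ih =>
    rw [Finset.sum_range_succ]
    have := Finset.sum_range_sub' (fun j : ℕ => eps (2 + j + n) ^ 2) M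
    simp only [Nat.cast_zero, add_zero] at this
    have h2 : ∑ j ∈ Finset.range M, (eps (2 + j) ^ 2 - eps (2 + j + (n + 1 : ℕ)) ^ 2) =
        ∑ j ∈ Finset.range M, (eps (2 + j) ^ 2 - eps (2 + j + n) ^ 2) +
        ∑ j ∈ Finset.range M, (eps (2 + j + n) ^ 2 - eps (2 + (j + 1 : ℕ) + n) ^ 2) := by
      rw [← Finset.sum_add_distrib]
      refine Finset.sum_congr rfl fun j _ => ?_
      push_cast
      ring_nf
    rw [h2, this]
    nlinarith [sq_nonneg (eps (2 + M + n))]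

lemma sum_eps (n : ℕ) : ∑ j ∈ Finset.range n, eps (2 + j) ^ 2 ≤ Real.log (n + 1) := by
  have h := harmonic_le_one_add_log (n + 1)
  have : (harmonic (n + 1) : ℝ) = 1 + ∑ j ∈ Finset.range n, eps (2 + j) ^ 2 := by
    rw [harmonic, Finset.sum_range_succ']
    push_cast
    rw [add_comm]
    congr 1
    · norm_num
    · refine Finset.sum_congr rfl fun j _ => ?_
      rw [eps_sq _ (by lia)]; push_cast; rw [one_div]; congr 1; ring
  rw [this] at h
  push_cast at h
  linarith

lemma sum_tot (n : ℕ) (F : Finset ℤ) :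
    ∑ i ∈ F, (eps i - eps (i + n)) ^ 2 ≤ 2 * Real.log (n + 1) := by
  obtain ⟨M, hM⟩ : ∃ M : ℕ, ∀ i ∈ F, i.natAbs + 2 < M :=
    ⟨∑ i ∈ F, (i.natAbs + 2) + 1, fun i hi => Nat.lt_succ_of_le
      (Finset.single_le_sum (f := fun i : ℤ => i.natAbs + 2) (fun _ _ => Nat.zero_le _) hi)⟩
  rw [← Finset.sum_filter_add_sum_filter_not F (fun i => i ≤ 1)]
  have hA : ∑ i ∈ F with i ≤ 1, (eps i - eps (i + n)) ^ 2 ≤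
      ∑ j ∈ Finset.range M, eps (1 - j + n) ^ 2 := by
    have hinj : Set.InjOn (fun j : ℕ => (1 - j : ℤ)) (Finset.range M) := by
      intro x _ y _ h; simp at h; exact h
    rw [← Finset.sum_image (g := fun j : ℕ => (1 - j : ℤ)) (f := fun i : ℤ => eps (i + n) ^ 2) hinj]
    refine (Finset.sum_le_sum (g := fun i : ℤ => eps (i + n) ^ 2) fun i hi => ?_).trans
      (Finset.sum_le_sum_of_subset_of_nonneg ?_ fun _ _ _ => sq_nonneg _)
    · have := sq_sub_le i n
      rwa [if_pos (Finset.mem_filter.1 hi).2] at this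
    · intro i hi
      rw [Finset.mem_filter] at hi
      have := hM i hi.1
      rw [Finset.mem_image]
      exact ⟨(1 - i).toNat, by simp; lia, by simp; lia⟩
  have hB : ∑ i ∈ F with ¬ i ≤ 1, (eps i - eps (i + n)) ^ 2 ≤
      ∑ j ∈ Finset.range M, (eps (2 + j) ^ 2 - eps (2 + j + n) ^ 2) := by
    have hinj : Set.InjOn (fun j : ℕ => (2 + j : ℤ)) (Finset.range M) := by
      intro x _ y _ h; simp at h; exact h
    rw [← Finset.sum_image (g := fun j : ℕ => (2 + j : ℤ))
      (f := fun i : ℤ => eps i ^ 2 - eps (i + n) ^ 2) hinj]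
    refine (Finset.sum_le_sum (g := fun i : ℤ => eps i ^ 2 - eps (i + n) ^ 2) fun i hi => ?_).trans
      (Finset.sum_le_sum_of_subset_of_nonneg ?_ fun i hi _ => ?_)
    · have := sq_sub_le i n
      rwa [if_neg (Finset.mem_filter.1 hi).2] at this
    · intro i hi
      rw [Finset.mem_filter] at hi
      have := hM i hi.1
      rw [Finset.mem_image]
      exact ⟨(i - 2).toNat, by simp; lia, by simp; lia⟩
    · obtain ⟨j, _, rfl⟩ := Finset.mem_image.1 hi
      have := sq_sub_le (2 + j) n
      rw [if_neg (by lia)] at this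
      exact (sq_nonneg _).trans this
  linarith [sumA M n, sumB M n, sum_eps n]

lemma exp_lip {x y : ℝ} (hx : x ≤ 0) (hy : y ≤ 0) :
    (Real.exp x - Real.exp y) ^ 2 ≤ (x - y) ^ 2 := by
  wlog h : y ≤ x generalizing x y
  · have := this hy hx (le_of_not_ge h); linarith [this, sq_nonneg (x - y)]
  have h1 : Real.exp y ≤ Real.exp x := Real.exp_le_exp.2 h
  have h2 : Real.exp x ≤ 1 := Real.exp_le_one_iff.2 hx
  have h3 : Real.exp y = Real.exp x * Real.exp (y - x) := by rw [← Real.exp_add]; congr 1; ring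
  have h4 := Real.add_one_le_exp (y - x)
  have h5 := Real.exp_pos x
  have : Real.exp x - Real.exp y ≤ x - y := by rw [h3]; nlinarith
  exact pow_le_pow_left₀ (by linarith) this 2

lemma term_bound (a : ℝ) (ha : 0 < a) (ha' : a < 1 / 6) (i j k : ℤ) :
    (a * Real.exp (eps i) - a * Real.exp (eps j)) ^ 2 / (a * Real.exp (eps k)) ≤
      (1 / 2) * (eps i - eps j) ^ 2 := by
  have h := exp_lip (eps_nonpos i) (eps_nonpos j)
  have h1 : 1 / 3 ≤ Real.exp (eps k) := by
    have h2 : Real.exp (-1) ≤ Real.exp (eps k) := Real.exp_le_exp.2 (eps_ge k)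
    have h3 : Real.exp (-1) * Real.exp 1 = 1 := by rw [← Real.exp_add]; simp
    nlinarith [Real.exp_one_lt_d9, Real.exp_pos (-1)]
  rw [div_le_iff₀ (by positivity)]
  have h2 : (a * Real.exp (eps i) - a * Real.exp (eps j)) ^ 2 =
    a * (a * (Real.exp (eps i) - Real.exp (eps j)) ^ 2) := by ring
  rw [h2]
  have h3 : a * (Real.exp (eps i) - Real.exp (eps j)) ^ 2 ≤ 1 / 6 * (eps i - eps j) ^ 2 :=
    mul_le_mul ha'.le h (sq_nonneg _) (by norm_num)
  have h4 : 1 / 6 * (eps i - eps j) ^ 2 ≤ 1 / 2 * (eps i - eps j) ^ 2 * Real.exp (eps k) := by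
    nlinarith [sq_nonneg (eps i - eps j)]
  calc _ ≤ a * (1 / 2 * (eps i - eps j) ^ 2 * Real.exp (eps k)) :=
        mul_le_mul_of_nonneg_left (h3.trans h4) ha.le
    _ = _ := by ring

lemma exp_bound (a : ℝ) (ha : 0 < a) (ha' : a < 1 / 6) (n : ℕ) (F : Finset ℤ) :
    Real.exp (∑ i ∈ F, (a * Real.exp (eps i) - a * Real.exp (eps (i + n))) ^ 2 /
      (a * Real.exp (eps (i + n)))) ≤ n + 1 ∧
    Real.exp (∑ i ∈ F, (a * Real.exp (eps (i + n)) - a * Real.exp (eps i)) ^ 2 /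
      (a * Real.exp (eps i))) ≤ n + 1 := by
  have h := sum_tot n F
  constructor
  all_goals
    rw [← Real.le_log_iff_exp_le (by positivity)]
    refine le_trans (Finset.sum_le_sum
      (g := fun i : ℤ => (1 / 2) * (eps i - eps (i + n)) ^ 2) fun i _ => ?_) ?_
    rotate_left
    · rw [← Finset.mul_sum]; linarith
  · exact term_bound a ha ha' i (i + n) (i + n)
  · rw [sub_sq_comm (eps i)]
    exact term_bound a ha ha' (i + n) i i

/-- With `a_n := a e^{ε_n}` where `ε_n = -n^{-1/2}` for `n ≥ 2` and `ε_n = 0` for `n ≤ 1`: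
if `0 < a < 1/6` then the shift on `(ℕ^ℤ, η)`, `η = ⊗_{n∈ℤ} Pois(a e^{ε_n})`, is
nonsingular and conservative. -/
theorem stmt14 (a : ℝ) (ha : 0 < a) (ha' : a < 1 / 6)
    (η : Measure (ℤ → ℕ)) [IsProbabilityMeasure η]
    (hη : IsProductOf η fun n => pois (a * Real.exp (eps n))) :
    (η.map ⇑shift ≪ η ∧ η ≪ η.map ⇑shift) ∧
    (∀ B : Set (ℤ → ℕ), MeasurableSet B → 0 < η B →
      ∃ n : ℕ, 0 < n ∧ 0 < η (⇑(shift ^ n) ⁻¹' B ∩ B)) := by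
  have hpr : ∀ n : ℕ, IsProbabilityMeasure (η.map ⇑(shift ^ n)) := fun n =>
    Measure.isProbabilityMeasure_map (meas_shift n).aemeasurable
  have hpos : ∀ i : ℤ, 0 < a * Real.exp (eps i) := fun i => by positivity
  have k1 : ∀ (n : ℕ) (B : Set (ℤ → ℕ)), MeasurableSet B →
      η.real B ^ 2 ≤ (n + 1) * (η.map ⇑(shift ^ n)).real B := fun n B hB =>
    key η (η.map ⇑(shift ^ n)) (fun i => a * Real.exp (eps i))
      (fun i => a * Real.exp (eps (i + n))) hpos (fun i => hpos _) hη (prod_shift η _ hη n)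
      (n + 1) (fun F => (exp_bound a ha ha' n F).1) B hB
  have k2 : ∀ (n : ℕ) (B : Set (ℤ → ℕ)), MeasurableSet B →
      (η.map ⇑(shift ^ n)).real B ^ 2 ≤ (n + 1) * η.real B := fun n B hB =>
    key (η.map ⇑(shift ^ n)) η (fun i => a * Real.exp (eps (i + n)))
      (fun i => a * Real.exp (eps i)) (fun i => hpos _) hpos (prod_shift η _ hη n) hη
      (n + 1) (fun F => (exp_bound a ha ha' n F).2) B hB
  have ac1 : ∀ n : ℕ, η.map ⇑(shift ^ n) ≪ η := fun n =>
    Measure.AbsolutelyContinuous.mk fun s hs h0 => by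
      have := k2 n s hs
      rw [(measureReal_eq_zero_iff).2 h0, mul_zero] at this
      exact (measureReal_eq_zero_iff).1 (pow_eq_zero_iff two_ne_zero |>.1
        (le_antisymm this (sq_nonneg _)))
  have ac2 : ∀ n : ℕ, η ≪ η.map ⇑(shift ^ n) := fun n =>
    Measure.AbsolutelyContinuous.mk fun s hs h0 => by
      have := k1 n s hs
      rw [(measureReal_eq_zero_iff).2 h0, mul_zero] at this
      exact (measureReal_eq_zero_iff).1 (pow_eq_zero_iff two_ne_zero |>.1
        (le_antisymm this (sq_nonneg _)))
  refine ⟨⟨by simpa using ac1 1, by simpa using ac2 1⟩, fun B hB hB0 => ?_⟩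
  by_contra hcon
  push Not at hcon
  have hz : ∀ n : ℕ, 0 < n → η (⇑(shift ^ n) ⁻¹' B ∩ B) = 0 := fun n hn =>
    le_antisymm (hcon n hn) (zero_le)
  have hmB : ∀ n : ℕ, MeasurableSet (⇑(shift ^ n) ⁻¹' B) := fun n => meas_shift n hB
  have hd : ∀ m d : ℕ, 0 < d → η (⇑(shift ^ (m + d)) ⁻¹' B ∩ ⇑(shift ^ m) ⁻¹' B) = 0 := by
    intro m d hd
    have h := ac1 m (hz d hd)
    rw [Measure.map_apply (meas_shift m) ((hmB d).inter hB)] at h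
    rw [← h, add_comm, pow_add]
    rfl
  have hdisj : Pairwise (Function.onFun (AEDisjoint η) fun n : ℕ => ⇑(shift ^ n) ⁻¹' B) := by
    intro m n hmn
    rcases lt_or_gt_of_ne hmn with h | h
    · have := hd m (n - m) (by lia)
      rw [show m + (n - m) = n by lia, Set.inter_comm] at this
      exact this
    · have := hd n (m - n) (by lia)
      rw [show n + (m - n) = m by lia] at this
      exact this
  have hU := measure_iUnion₀ hdisj (fun n => (hmB n).nullMeasurableSet)
  have hfin : ∑' n : ℕ, η (⇑(shift ^ n) ⁻¹' B) ≠ ⊤ := by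
    rw [← hU]; finiteness
  have hsum := ENNReal.summable_toReal hfin
  have hc : 0 < η.real B := by
    rw [measureReal_def]; exact ENNReal.toReal_pos hB0.ne' (by finiteness)
  have hs2 : Summable fun n : ℕ => η.real B ^ 2 * (1 / ((n + 1 : ℕ) : ℝ)) := by
    refine Summable.of_nonneg_of_le (fun n => by positivity) (fun n => ?_) hsum
    have := k1 n B hB
    rw [map_measureReal_apply (meas_shift n) hB] at this
    rw [mul_one_div, div_le_iff₀ (by positivity), mul_comm]
    push_cast
    exact this
  rw [summable_mul_left_iff (by positivity)] at hs2
  exact Real.not_summable_one_div_natCast ((summable_nat_add_iff 1).1 hs2)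
end

section
/- Define ε : ℤ → ℝ by ε_k = −k^{-1/2} for integers k ≥ 2 and ε_k = 0 for k ≤ 1, and set a_n := a e^{ε_n} for n ∈ ℤ. If a > 4, then the shift σ on (ℕ^ℤ, η) with η = ⊗_{n∈ℤ} Pois(a e^{ε_n}) is totally dissipative. -/
open MeasureTheory ProbabilityTheory Filter

namespace S16
open scoped ENNReal NNReal Topology

instance (a : ℝ) : IsProbabilityMeasure (pois a) := by unfold pois; infer_instance

lemma eta_eq (μ : ℤ → Measure ℕ) [∀ i, IsProbabilityMeasure (μ i)]
    (η : Measure (ℤ → ℕ)) [IsProbabilityMeasure η] (hη : IsProductOf η μ) :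
    η = Measure.infinitePi μ := by
  refine (Measure.isProjectiveLimit_infinitePi μ).unique ?_ |>.symm
  intro s
  refine Measure.ext_of_singleton fun v => ?_
  rw [Measure.pi_singleton, Measure.map_apply (Finset.measurable_restrict s) (measurableSet_singleton _)]
  have := hη s (fun i => if h : i ∈ s then v ⟨i, h⟩ else 0)
  rw [← Finset.prod_attach] at this
  refine Eq.trans (congrArg η ?_) (this.trans (Finset.prod_congr rfl fun i _ => ?_))
  · ext y
    simp only [Set.mem_preimage, Set.mem_singleton_iff, Set.mem_ofPred_eq, funext_iff]
    constructor
    · intro h i hi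
      simpa [hi] using h ⟨i, hi⟩
    · rintro h ⟨i, hi⟩
      simpa [hi] using h i hi
  · rw [dif_pos i.2]

lemma lint_pois (r : ℝ) (hr : 0 ≤ r) (f : ℕ → ℝ) (hf : ∀ n, 0 ≤ f n) (s : ℝ)
    (h : HasSum (fun n : ℕ => Real.exp (-r) * r ^ n / n.factorial * f n) s) :
    ∫⁻ n, ENNReal.ofReal (f n) ∂(pois r) = ENNReal.ofReal s := by
  rw [lintegral_countable']
  unfold pois
  simp_rw [poissonMeasure_singleton, Real.coe_toNNReal r hr]
  rw [← h.tsum_eq, ENNReal.ofReal_tsum_of_nonneg _ h.summable]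
  · congr 1
    ext n
    rw [mul_comm, ENNReal.ofReal_mul (by positivity)]
  · intro n
    have := hf n
    positivity

lemma lint_exp (r : ℝ) (hr : 0 ≤ r) (t : ℝ) :
    ∫⁻ n, ENNReal.ofReal (Real.exp (t * n)) ∂(pois r) =
      ENNReal.ofReal (Real.exp (r * (Real.exp t - 1))) := by
  apply lint_pois r hr _ (fun n => (Real.exp_pos _).le)
  have := (NormedSpace.expSeries_div_hasSum_exp (r * Real.exp t)).mul_left (Real.exp (-r))
  convert! this using 1
  · ext n
    rw [mul_pow, ← Real.exp_nat_mul]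
    ring_nf
  · rw [← Real.exp_eq_exp_ℝ, ← Real.exp_add]
    ring_nf

lemma lint_id (r : ℝ) (hr : 0 ≤ r) :
    ∫⁻ n, ENNReal.ofReal ((n : ℕ) : ℝ) ∂(pois r) = ENNReal.ofReal r := by
  apply lint_pois r hr _ (fun n => by positivity)
  rw [hasSum_nat_add_iff' 1 |>.symm]
  have := (NormedSpace.expSeries_div_hasSum_exp r).mul_left (Real.exp (-r) * r)
  convert! this using 1
  · ext n
    rw [Nat.factorial_succ]
    push_cast
    field_simp
    ring
  · rw [← Real.exp_eq_exp_ℝ, mul_right_comm, ← Real.exp_add]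
    simp

lemma lint_cyl (μ : ℤ → Measure ℕ) [∀ i, IsProbabilityMeasure (μ i)]
    (F : Finset ℤ) (f : ℤ → ℕ → ℝ≥0∞) :
    ∫⁻ y, ∏ k ∈ F, f k (y k) ∂(Measure.infinitePi μ) = ∏ k ∈ F, ∫⁻ n, f k n ∂(μ k) := by
  rw [lintegral_prod_eq_prod_lintegral_of_indepFun F (fun k (y : ℤ → ℕ) => f k (y k))
    (iIndepFun_infinitePi (fun i => measurable_of_countable _))
    (fun i => (measurable_of_countable (f i)).comp (measurable_pi_apply i))]
  refine Finset.prod_congr rfl fun k _ => ?_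
  rw [← (measurePreserving_eval_infinitePi μ k).lintegral_comp (measurable_of_countable (f k))]

end S16
namespace S16
open scoped ENNReal NNReal Topology

/-- half-density -/
noncomputable def vv (k : ℤ) : ℝ := Real.exp (eps k / 2)

noncomputable def uu (k : ℤ) : ℝ := 1 - vv k

lemma uu_le_one {k : ℤ} (hk : k ≤ 1) : uu k = 0 := by
  simp [uu, vv, eps, show ¬ (2 ≤ k) by omega]

lemma uu_le (j : ℕ) (hj : 2 ≤ j) : uu j ≤ (Real.sqrt j)⁻¹ / 2 := by
  have h2 : (2:ℤ) ≤ j := by exact_mod_cast hj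
  simp only [uu, vv, eps, if_pos h2]
  have := Real.add_one_le_exp (-(Real.sqrt ((j:ℤ):ℝ))⁻¹ / 2)
  push_cast at this ⊢
  linarith

lemma uu_nonneg (j : ℕ) (hj : 2 ≤ j) : 0 ≤ uu j := by
  have h2 : (2:ℤ) ≤ j := by exact_mod_cast hj
  simp only [uu, vv, eps, if_pos h2]
  have : Real.exp (-(Real.sqrt ((j:ℤ):ℝ))⁻¹ / 2) ≤ 1 := by
    apply Real.exp_le_one_iff.2
    have : 0 ≤ (Real.sqrt ((j:ℤ):ℝ))⁻¹ := by positivity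
    linarith
  linarith

lemma exp_neg_quad (t : ℝ) (ht : 0 ≤ t) : Real.exp (-t) ≤ 1 - t + t^2/2 := by
  have h1 := Real.quadratic_le_exp_of_nonneg ht
  rw [Real.exp_neg, inv_le_comm₀ (Real.exp_pos _) (by nlinarith [sq_nonneg (t-1)])]
  refine le_trans ?_ h1
  rw [inv_le_iff_one_le_mul₀ (by nlinarith [sq_nonneg (t-1)])]
  nlinarith [sq_nonneg (t^2)]

lemma uu_ge (j : ℕ) (hj : 2 ≤ j) :
    (1/4) * (j:ℝ)⁻¹ - (1/8) * ((j:ℝ)^(3/2:ℝ))⁻¹ ≤ uu j ^ 2 := by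
  have h2 : (2:ℤ) ≤ j := by exact_mod_cast hj
  have hj0 : (0:ℝ) < j := by positivity
  have hs : 0 < Real.sqrt j := Real.sqrt_pos.2 hj0
  have hs1 : 1 ≤ Real.sqrt j := Real.one_le_sqrt.2 (by exact_mod_cast (by omega : 1 ≤ j))
  set x := (Real.sqrt j)⁻¹ with hx
  have hx0 : 0 < x := by positivity
  have hx1 : x ≤ 1 := inv_le_one_of_one_le₀ hs1
  have e1 : (j:ℝ)⁻¹ = x^2 := by rw [hx, inv_pow, Real.sq_sqrt hj0.le]
  have e2 : ((j:ℝ)^(3/2:ℝ))⁻¹ = x^3 := by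
    rw [hx, inv_pow, Real.sqrt_eq_rpow, ← Real.rpow_natCast, ← Real.rpow_mul hj0.le]; norm_num
  have hu : x/2 - x^2/8 ≤ uu j := by
    simp only [uu, vv, eps, if_pos h2]
    have := exp_neg_quad (x/2) (by positivity)
    push_cast
    rw [← hx, neg_div]
    nlinarith
  rw [e1, e2]
  have h0 : 0 ≤ x/2 - x^2/8 := by nlinarith
  have := pow_le_pow_left₀ h0 hu 2
  nlinarith [sq_nonneg (x^2)]

lemma sum_inv_sqrt (n : ℕ) : ∑ j ∈ Finset.Icc 2 n, (Real.sqrt j)⁻¹ ≤ 2 * Real.sqrt n := by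
  induction n with
  | zero => simp
  | succ n ih =>
    by_cases h : 2 ≤ n + 1
    · rw [Finset.sum_Icc_succ_top h]
      have hn : (0:ℝ) ≤ n := by positivity
      have a1 : 0 < Real.sqrt ((n+1:ℕ):ℝ) := Real.sqrt_pos.2 (by positivity)
      have a2 := Real.sq_sqrt hn
      have a3 := Real.sq_sqrt (show (0:ℝ) ≤ ((n+1:ℕ):ℝ) by positivity)
      have : (Real.sqrt ((n+1:ℕ):ℝ))⁻¹ ≤ 2 * Real.sqrt ((n+1:ℕ):ℝ) - 2 * Real.sqrt n := by
        rw [inv_le_iff_one_le_mul₀ a1]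
        push_cast at a3 ⊢
        nlinarith [sq_nonneg (Real.sqrt ((n:ℝ)+1) - Real.sqrt n)]
      linarith
    · rw [Finset.Icc_eq_empty h]
      simp

lemma A_lower : ∃ C : ℝ, ∀ n : ℕ, 1 ≤ n →
    (1/4) * Real.log n - C ≤ ∑ j ∈ Finset.Icc 2 n, uu j ^ 2 := by
  have hS : Summable (fun j : ℕ => ((j:ℝ)^(3/2:ℝ))⁻¹) := Real.summable_nat_rpow_inv.2 (by norm_num)
  refine ⟨1/4 + (1/8) * ∑' j : ℕ, ((j:ℝ)^(3/2:ℝ))⁻¹, fun n hn => ?_⟩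
  have h1 : ∑ j ∈ Finset.Icc 2 n, ((1/4) * (j:ℝ)⁻¹ - (1/8) * ((j:ℝ)^(3/2:ℝ))⁻¹)
      ≤ ∑ j ∈ Finset.Icc 2 n, uu j ^ 2 :=
    Finset.sum_le_sum fun j hj => uu_ge j (Finset.mem_Icc.1 hj).1
  rw [Finset.sum_sub_distrib, ← Finset.mul_sum, ← Finset.mul_sum] at h1
  have h2 : ∑ j ∈ Finset.Icc 2 n, ((j:ℝ)^(3/2:ℝ))⁻¹ ≤ ∑' j : ℕ, ((j:ℝ)^(3/2:ℝ))⁻¹ :=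
    hS.sum_le_tsum _ (fun i _ => by positivity)
  have h3 := log_add_one_le_harmonic n
  rw [harmonic_eq_sum_Icc, ← Finset.add_sum_Ioc_eq_sum_Icc hn] at h3
  have h4 : Finset.Ioc 1 n = Finset.Icc 2 n := by ext; simp [Nat.succ_le_iff]
  rw [h4] at h3
  push_cast at h3
  have h5 : Real.log n ≤ Real.log (n+1) := Real.log_le_log (by positivity) (by linarith)
  norm_num at h3
  linarith

lemma V_lower : ∃ C : ℝ, ∀ n : ℕ, 1 ≤ n →
    (1/2) * Real.log n - C ≤ ∑ k ∈ Finset.Icc (2:ℤ) (2*n), (vv (k - n) - vv k) ^ 2 := by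
  obtain ⟨C, hC⟩ := A_lower
  refine ⟨2 * C + 1, fun n hn => ?_⟩
  have hA := hC n hn
  have key1 : ∑ k ∈ Finset.Icc (2:ℤ) n, (vv (k - n) - vv k) ^ 2 = ∑ j ∈ Finset.Icc 2 n, uu j ^ 2 := by
    symm
    refine Finset.sum_bij (fun j _ => (j:ℤ)) ?_ ?_ ?_ ?_
    · intro j hj; simp at hj ⊢; omega
    · intro i _ j _ h; exact_mod_cast h
    · intro k hk; simp at hk; exact ⟨k.toNat, by simp; omega, by omega⟩
    · intro j hj
      simp at hj
      have : uu ((j:ℤ) - n) = 0 := uu_le_one (by omega)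
      unfold uu at *
      rw [show vv ((j:ℤ)-n) = 1 by linarith]
  have key2 : ∑ k ∈ Finset.Icc (n+2:ℤ) (2*n), (vv (k - n) - vv k) ^ 2
      = ∑ j ∈ Finset.Icc 2 n, (uu j - uu ((j + n : ℕ):ℤ)) ^ 2 := by
    symm
    refine Finset.sum_bij (fun j _ => (j:ℤ) + n) ?_ ?_ ?_ ?_
    · intro j hj; simp at hj ⊢; omega
    · intro i _ j _ h; simpa using h
    · intro k hk; simp at hk; exact ⟨(k-n).toNat, by simp; omega, by simp; omega⟩
    · intro j hj
      simp [uu]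
      ring
  have key3 : ∑ j ∈ Finset.Icc 2 n, uu j ^ 2 - 1
      ≤ ∑ j ∈ Finset.Icc 2 n, (uu j - uu ((j + n : ℕ):ℤ)) ^ 2 := by
    have hn0 : 0 < Real.sqrt n := Real.sqrt_pos.2 (by positivity)
    have : ∑ j ∈ Finset.Icc 2 n, (uu j ^ 2 - (1/2) * (Real.sqrt n)⁻¹ * (Real.sqrt j)⁻¹)
      ≤ ∑ j ∈ Finset.Icc 2 n, (uu j - uu ((j + n : ℕ):ℤ)) ^ 2 := by
      refine Finset.sum_le_sum fun j hj => ?_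
      have hj2 := (Finset.mem_Icc.1 hj).1
      have b1 := uu_le j hj2
      have b2 := uu_le (j+n) (by omega)
      have b3 := uu_nonneg j hj2
      have b4 := uu_nonneg (j+n) (by omega)
      have b5 : (Real.sqrt ((j+n:ℕ):ℝ))⁻¹ ≤ (Real.sqrt n)⁻¹ := by
        apply inv_anti₀ hn0
        apply Real.sqrt_le_sqrt
        push_cast
        have : (0:ℝ) ≤ j := by positivity
        linarith
      have b6 := mul_le_mul b1 (b2.trans (div_le_div_of_nonneg_right b5 zero_le_two)) b4 (by positivity)
      nlinarith [sq_nonneg (uu ((j + n : ℕ):ℤ))]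
    rw [Finset.sum_sub_distrib, ← Finset.mul_sum] at this
    have h := mul_le_mul_of_nonneg_left (sum_inv_sqrt n) (show 0 ≤ (1/2) * (Real.sqrt n)⁻¹ by positivity)
    have : (1/2) * (Real.sqrt n)⁻¹ * (2 * Real.sqrt n) = 1 := by field_simp
    linarith
  have hd : Disjoint (Finset.Icc (2:ℤ) n) (Finset.Icc (n+2:ℤ) (2*n)) := by
    rw [Finset.disjoint_left]; intro x; simp; omega
  have hsub : Finset.Icc (2:ℤ) n ∪ Finset.Icc (n+2:ℤ) (2*n) ⊆ Finset.Icc (2:ℤ) (2*n) := by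
    intro x; simp; omega
  have := Finset.sum_le_sum_of_subset_of_nonneg hsub
    (f := fun k => (vv (k - n) - vv k) ^ 2) (fun i _ _ => sq_nonneg _)
  rw [Finset.sum_union hd] at this
  linarith

/-- a finite window capturing the Hellinger sum -/
lemma V_lower_int : ∃ C : ℝ, ∀ n : ℤ, n ≠ 0 → ∃ T : Finset ℤ,
    (1/2) * Real.log |(n:ℝ)| - C ≤ ∑ k ∈ T, (vv (k - n) - vv k) ^ 2 := by
  obtain ⟨C, hC⟩ := V_lower
  refine ⟨C, fun n hn => ?_⟩
  rcases lt_or_gt_of_ne hn with h | h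
  · lift -n to ℕ using (by omega) with m hm
    refine ⟨(Finset.Icc (2:ℤ) (2*m)).map (addRightEmbedding (-(m:ℤ))), ?_⟩
    rw [Finset.sum_map]
    have e : |(n:ℝ)| = m := by
      rw [abs_of_neg (by exact_mod_cast h)]; exact_mod_cast hm.symm
    rw [e]
    refine (hC m (by omega)).trans (le_of_eq (Finset.sum_congr rfl fun k _ => ?_))
    simp only [addRightEmbedding_apply]
    rw [show k + -(m:ℤ) - n = k by omega, show k + -(m:ℤ) = k - m by ring]
    ring
  · lift n to ℕ using h.le
    exact ⟨Finset.Icc 2 (2 * n), by simpa using hC n (by omega)⟩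

noncomputable def dd (n k : ℤ) : ℝ := eps (k - n) - eps k

noncomputable def cc (n : ℤ) (y : ℤ → ℕ) : ℝ := ∑' k, dd n k * (y k : ℝ)

def X0 : Set (ℤ → ℕ) := {y | ∀ n, Summable (fun k => dd n k * (y k : ℝ))}

lemma mem_X0 (y : ℤ → ℕ) : y ∈ X0 ↔ ∀ n, Summable (fun k => dd n k * (y k : ℝ)) := Iff.rfl

lemma shift_zpow (m : ℤ) (y : ℤ → ℕ) (k : ℤ) : (shift ^ m) y k = y (k + m) := by
  induction m using Int.induction_on generalizing y k with
  | zero => simp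
  | succ i ih =>
    rw [zpow_add_one, Equiv.Perm.mul_apply, ih]
    show y (k + i + 1) = _
    rw [add_assoc]
  | pred i ih =>
    rw [zpow_sub_one, Equiv.Perm.mul_apply, ih]
    show y (k + -i - 1) = _
    congr 1
    ring

lemma dd_shift (n m k : ℤ) : dd n (k - m) = dd (n + m) k - dd m k := by
  unfold dd
  rw [show k - m - n = k - (n + m) by ring]; ring

lemma summ_shift {y : ℤ → ℕ} (hy : y ∈ X0) (n m : ℤ) :
    HasSum (fun k => dd n k * (((shift ^ m) y k : ℕ) : ℝ)) (cc (n + m) y - cc m y) := by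
  rw [← (Equiv.subRight m).hasSum_iff]
  have := (hy (n+m)).hasSum.sub (hy m).hasSum
  refine this.congr_fun fun k => ?_
  simp only [Function.comp_apply, Equiv.subRight_apply, shift_zpow, dd_shift, sub_add_cancel]
  ring

lemma X0_shift {y : ℤ → ℕ} (hy : y ∈ X0) (m : ℤ) : (shift ^ m) y ∈ X0 :=
  fun n => (summ_shift hy n m).summable

lemma cc_shift {y : ℤ → ℕ} (hy : y ∈ X0) (n m : ℤ) :
    cc n ((shift ^ m) y) = cc (n + m) y - cc m y := (summ_shift hy n m).tsum_eq

lemma cc_zero (y : ℤ → ℕ) : cc 0 y = 0 := by simp [cc, dd]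

lemma meas_cc (n : ℤ) : Measurable (cc n) := by
  unfold cc
  apply Measurable.tsum
  intro k
  fun_prop

lemma meas_X0 : MeasurableSet X0 := by
  have : X0 = ⋂ n, {y : ℤ → ℕ | Summable (fun k => dd n k * (y k : ℝ))} := by
    ext y; simp [X0]
  rw [this]
  refine MeasurableSet.iInter fun n => ?_
  exact measurableSet_exists_tendsto (by fun_prop)

lemma summ_dd_one : Summable (dd 1) := by
  apply Summable.of_nat_of_neg_add_one
  · rw [← summable_nat_add_iff 3]
    have hd : ∀ i : ℕ, -dd 1 ((i + 3 : ℕ) : ℤ)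
        = (Real.sqrt ((i:ℝ)+2))⁻¹ - (Real.sqrt (((i+1:ℕ):ℝ)+2))⁻¹ := by
      intro i
      have h1 : (2:ℤ) ≤ ((i+3:ℕ):ℤ) - 1 := by push_cast; omega
      have h2 : (2:ℤ) ≤ ((i+3:ℕ):ℤ) := by push_cast; omega
      simp only [dd, eps, if_pos h1, if_pos h2]
      push_cast
      rw [show (i:ℝ)+3-1 = i+2 by ring, show (i:ℝ)+1+2 = i+3 by ring]
      ring
    rw [← summable_neg_iff]
    apply summable_of_sum_range_le (c := (Real.sqrt ((0:ℕ)+2:ℝ))⁻¹)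
    · intro i
      rw [hd, sub_nonneg]
      apply inv_anti₀ (Real.sqrt_pos.2 (by positivity))
      apply Real.sqrt_le_sqrt
      push_cast; linarith
    · intro n
      simp_rw [hd]
      rw [Finset.sum_range_sub' (fun i : ℕ => (Real.sqrt ((i:ℝ)+2))⁻¹)]
      have : 0 ≤ (Real.sqrt ((n:ℝ)+2))⁻¹ := by positivity
      linarith
  · convert! summable_zero with n
    have h1 : ¬ (2:ℤ) ≤ -((n:ℤ)+1) - 1 := by omega
    have h2 : ¬ (2:ℤ) ≤ -((n:ℤ)+1) := by omega
    simp only [dd, eps, if_neg h1, if_neg h2, sub_zero]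

lemma summ_dd (n : ℤ) : Summable (dd n) := by
  induction n using Int.induction_on with
  | zero =>
    have : dd 0 = fun _ => 0 := by ext k; simp [dd]
    rw [this]; exact summable_zero
  | succ i ih =>
    have h := ((Equiv.subRight (i:ℤ)).summable_iff.2 summ_dd_one).add ih
    refine h.congr fun k => ?_
    simp only [Function.comp_apply, Equiv.subRight_apply, dd]
    rw [show k - (i:ℤ) - 1 = k - (i + 1) by ring]; ring
  | pred i ih =>
    have h := ih.sub ((Equiv.subRight (-(i:ℤ) - 1)).summable_iff.2 summ_dd_one)
    refine h.congr fun k => ?_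
    simp only [Function.comp_apply, Equiv.subRight_apply, dd]
    rw [show k - (-(i:ℤ) - 1) - 1 = k - -i by ring]; ring

noncomputable def mu (a : ℝ) (n : ℤ) : Measure ℕ := pois (a * Real.exp (eps n))

instance (a : ℝ) (n : ℤ) : IsProbabilityMeasure (mu a n) := by unfold mu; infer_instance

lemma eps_nonpos (k : ℤ) : eps k ≤ 0 := by
  unfold eps; split_ifs <;> simp

lemma ae_X0 (a : ℝ) (ha : 0 < a) : ∀ᵐ y ∂(Measure.infinitePi (mu a)), y ∈ X0 := by
  simp only [mem_X0]
  rw [ae_all_iff]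
  intro n
  have hm : ∀ k, Measurable (fun y : ℤ → ℕ => ENNReal.ofReal |dd n k| * ENNReal.ofReal ((y k : ℕ) : ℝ)) := by
    intro k; fun_prop
  have hlt : ∀ᵐ y ∂(Measure.infinitePi (mu a)),
      ∑' k, ENNReal.ofReal |dd n k| * ENNReal.ofReal ((y k : ℕ) : ℝ) < ⊤ := by
    apply ae_lt_top (Measurable.tsum hm)
    rw [lintegral_tsum (fun k => (hm k).aemeasurable)]
    have hk : ∀ k, ∫⁻ y, ENNReal.ofReal |dd n k| * ENNReal.ofReal ((y k : ℕ) : ℝ)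
        ∂(Measure.infinitePi (mu a)) ≤ ENNReal.ofReal (|dd n k| * a) := by
      intro k
      rw [lintegral_const_mul _ (by fun_prop),
        (measurePreserving_eval_infinitePi (mu a) k).lintegral_comp
          (f := fun m : ℕ => ENNReal.ofReal (m:ℝ)) (by fun_prop)]
      unfold mu
      rw [lint_id _ (by positivity), ENNReal.ofReal_mul (abs_nonneg _)]
      gcongr
      have := Real.exp_le_one_iff.2 (eps_nonpos k)
      nlinarith
    refine ne_top_of_le_ne_top ?_ (ENNReal.tsum_le_tsum hk)
    exact ((summ_dd n).abs.mul_right a).tsum_ofReal_ne_top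
  filter_upwards [hlt] with y hy
  have : Summable (fun k => |dd n k| * (y k : ℝ)) := by
    have h := ENNReal.summable_toReal hy.ne
    refine h.congr fun k => ?_
    rw [← ENNReal.ofReal_mul (abs_nonneg _), ENNReal.toReal_ofReal (by positivity)]
  apply Summable.of_norm
  refine this.congr fun k => ?_
  simp [abs_mul]

lemma eps_top : Tendsto (fun N : ℕ => eps (N : ℤ)) atTop (𝓝 0) := by
  have h : Tendsto (fun N : ℕ => -(Real.sqrt (N:ℝ))⁻¹) atTop (𝓝 (-0)) :=
    (tendsto_inv_atTop_zero.comp (Real.tendsto_sqrt_atTop.comp tendsto_natCast_atTop_atTop)).neg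
  rw [neg_zero] at h
  refine h.congr' ?_
  filter_upwards [eventually_ge_atTop 2] with N hN
  simp [eps, hN]

lemma eps_top_sub (m : ℤ) : Tendsto (fun N : ℕ => eps ((N : ℤ) - m)) atTop (𝓝 0) := by
  have : Tendsto (fun N : ℕ => ((N:ℤ) - m).toNat) atTop atTop := by
    rw [tendsto_atTop]
    intro b
    filter_upwards [eventually_ge_atTop (b + m.toNat)] with N hN
    omega
  refine (eps_top.comp this).congr' ?_
  filter_upwards [eventually_ge_atTop m.toNat] with N hN
  simp only [Function.comp_apply]
  congr 1
  omega

lemma eps_bot_sub (m : ℤ) : Tendsto (fun N : ℕ => eps (-(N : ℤ) - m)) atTop (𝓝 0) := by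
  refine tendsto_const_nhds.congr' ?_
  filter_upwards [eventually_ge_atTop m.natAbs] with N hN
  rw [eps, if_neg (by omega)]

lemma tele1 (m : ℤ) : Tendsto (fun N : ℕ => ∑ k ∈ Finset.Ico (-(N:ℤ)) N,
    (Real.exp (eps (k - (m + 1))) - Real.exp (eps (k - m)))) atTop (𝓝 0) := by
  have h1 := (Real.continuous_exp.tendsto 0).comp (eps_bot_sub (m+1))
  have h2 := (Real.continuous_exp.tendsto 0).comp (eps_top_sub (m+1))
  have h3 := h1.sub h2
  rw [sub_self] at h3
  refine h3.congr fun N => ?_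
  have := Finset.sum_Ico_int_sub N (fun k => Real.exp (eps (k - (m+1))))
  simp only [Function.comp_apply]
  rw [← this]
  refine Finset.sum_congr rfl fun k _ => ?_
  rw [show k + 1 - (m + 1) = k - m by ring]

lemma tele (n : ℤ) : Tendsto (fun N : ℕ => ∑ k ∈ Finset.Ico (-(N:ℤ)) N,
    (Real.exp (eps (k - n)) - Real.exp (eps k))) atTop (𝓝 0) := by
  induction n using Int.induction_on with
  | zero => simp
  | succ i ih =>
    have := (tele1 i).add ih
    rw [zero_add] at this
    refine this.congr fun N => ?_
    rw [← Finset.sum_add_distrib]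
    exact Finset.sum_congr rfl fun k _ => by ring
  | pred i ih =>
    have := ih.sub (tele1 (-(i:ℤ) - 1))
    rw [sub_zero] at this
    refine this.congr fun N => ?_
    rw [← Finset.sum_sub_distrib]
    refine Finset.sum_congr rfl fun k _ => ?_
    rw [show -(i:ℤ) - 1 + 1 = -i by ring]; ring

lemma lint_fin (a : ℝ) (ha : 0 < a) (n : ℤ) (F : Finset ℤ) :
    ∫⁻ y, ENNReal.ofReal (Real.exp (∑ k ∈ F, dd n k / 2 * (y k : ℝ))) ∂(Measure.infinitePi (mu a)) =
    ENNReal.ofReal (Real.exp (-(a/2) * ∑ k ∈ F, (vv (k - n) - vv k)^2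
      + (a/2) * ∑ k ∈ F, (Real.exp (eps (k - n)) - Real.exp (eps k)))) := by
  simp_rw [Real.exp_sum, ENNReal.ofReal_prod_of_nonneg (fun _ _ => (Real.exp_pos _).le)]
  rw [lint_cyl (mu a) F (fun k m => ENNReal.ofReal (Real.exp (dd n k / 2 * (m:ℝ))))]
  unfold mu
  simp_rw [fun k => lint_exp (a * Real.exp (eps k)) (by positivity) (dd n k / 2)]
  rw [← ENNReal.ofReal_prod_of_nonneg (fun _ _ => (Real.exp_pos _).le), ← Real.exp_sum,
    Finset.mul_sum, Finset.mul_sum, ← Finset.sum_add_distrib]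
  congr 2
  refine Finset.sum_congr rfl fun k _ => ?_
  have e1 : Real.exp (dd n k / 2) = vv (k - n) / vv k := by
    unfold vv; rw [← Real.exp_sub]; unfold dd; ring_nf
  have e2 : ∀ j, Real.exp (eps j) = vv j ^ 2 := by
    intro j; unfold vv; rw [← Real.exp_nat_mul]; congr 1; push_cast; ring
  have hv : vv k ≠ 0 := (Real.exp_pos _).ne'
  rw [e1, e2, e2]
  field_simp
  ring

lemma lint_cc (a : ℝ) (ha : 0 < a) (n : ℤ) (T : Finset ℤ) :
    ∫⁻ y, ENNReal.ofReal (Real.exp (cc n y / 2)) ∂(Measure.infinitePi (mu a)) ≤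
    ENNReal.ofReal (Real.exp (-(a/2) * ∑ k ∈ T, (vv (k - n) - vv k)^2)) := by
  set F : ℕ → Finset ℤ := fun N => Finset.Ico (-(N:ℤ)) N with hF
  have hFt : Tendsto F atTop atTop := Finset.tendsto_Ico_neg
  have h1 : ∀ᵐ y ∂(Measure.infinitePi (mu a)), ENNReal.ofReal (Real.exp (cc n y / 2))
      = liminf (fun N => ENNReal.ofReal (Real.exp (∑ k ∈ F N, dd n k / 2 * (y k : ℝ)))) atTop := by
    filter_upwards [ae_X0 a ha] with y hy
    symm
    apply Tendsto.liminf_eq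
    apply ENNReal.tendsto_ofReal
    apply (Real.continuous_exp.tendsto _).comp
    have := ((hy n).hasSum.comp hFt).div_const 2
    refine this.congr fun N => ?_
    simp only [Function.comp_apply, Finset.sum_div]
    exact Finset.sum_congr rfl fun k _ => by ring
  rw [lintegral_congr_ae h1]
  refine (lintegral_liminf_le (fun N => by fun_prop)).trans ?_
  simp_rw [lint_fin a ha n]
  have hlim : Tendsto (fun N => ENNReal.ofReal (Real.exp (-(a/2) * ∑ k ∈ T, (vv (k - n) - vv k)^2
      + (a/2) * ∑ k ∈ F N, (Real.exp (eps (k - n)) - Real.exp (eps k))))) atTop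
      (𝓝 (ENNReal.ofReal (Real.exp (-(a/2) * ∑ k ∈ T, (vv (k - n) - vv k)^2)))) := by
    apply ENNReal.tendsto_ofReal
    apply (Real.continuous_exp.tendsto _).comp
    have := ((tele n).const_mul (a/2)).const_add (-(a/2) * ∑ k ∈ T, (vv (k - n) - vv k)^2)
    simpa using this
  rw [← hlim.liminf_eq]
  refine liminf_le_liminf ?_
  filter_upwards [hFt.eventually_ge_atTop T] with N hN
  have := Finset.sum_le_sum_of_subset_of_nonneg (show T ⊆ F N from hN)
    (f := fun k => (vv (k - n) - vv k) ^ 2) (fun i _ _ => sq_nonneg _)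
  apply ENNReal.ofReal_le_ofReal
  apply Real.exp_le_exp.2
  have := mul_le_mul_of_nonneg_left this (show 0 ≤ a/2 by positivity)
  linarith

lemma ae_tsum (a : ℝ) (ha : 4 < a) : ∀ᵐ y ∂(Measure.infinitePi (mu a)),
    ∑' n, ENNReal.ofReal (Real.exp (cc n y / 2)) < ⊤ := by
  have hm : ∀ n, Measurable (fun y => ENNReal.ofReal (Real.exp (cc n y / 2))) := fun n =>
    (Real.measurable_exp.comp ((meas_cc n).div_const 2)).ennreal_ofReal
  apply ae_lt_top (Measurable.tsum hm)
  rw [lintegral_tsum (fun k => (hm k).aemeasurable)]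
  obtain ⟨C, hC⟩ := V_lower_int
  set K := Real.exp (a/2 * C) with hK
  have hb : ∀ n : ℤ, ∫⁻ y, ENNReal.ofReal (Real.exp (cc n y / 2)) ∂(Measure.infinitePi (mu a))
      ≤ ENNReal.ofReal (K * |(n:ℝ)| ^ (-(a/4)) + if n = 0 then 1 else 0) := by
    intro n
    by_cases hn : n = 0
    · subst hn
      simp only [cc_zero, if_true]
      simp
      have : (0:ℝ) ≤ K * 0 ^ (-(a/4)) := by positivity
      rw [Real.zero_rpow (by linarith)]
      simp
    · obtain ⟨T, hT⟩ := hC n hn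
      refine (lint_cc a (by linarith) n T).trans (ENNReal.ofReal_le_ofReal ?_)
      have h0 : 0 < |(n:ℝ)| := abs_pos.2 (by exact_mod_cast hn)
      rw [if_neg hn, add_zero, Real.rpow_def_of_pos h0, hK, ← Real.exp_add]
      apply Real.exp_le_exp.2
      have := mul_le_mul_of_nonneg_left hT (show 0 ≤ a/2 by linarith)
      linarith
  refine ne_top_of_le_ne_top ?_ (ENNReal.tsum_le_tsum hb)
  apply Summable.tsum_ofReal_ne_top
  apply Summable.add
  · exact (Real.summable_abs_int_rpow (by linarith)).mul_left K
  · exact (hasSum_ite_eq (0:ℤ) (1:ℝ)).summable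

lemma exists_first_max (c : ℤ → ℝ) (h : {n | 0 ≤ c n}.Finite) (h0 : c 0 = 0) :
    ∃ m, (∀ n < m, c n < c m) ∧ ∀ n, c n ≤ c m := by
  obtain ⟨p, hp, hmax⟩ := Set.exists_max_image _ c h ⟨0, by simp [h0]⟩
  have hmax' : ∀ n, c n ≤ c p := by
    intro n
    by_cases hn : 0 ≤ c n
    · exact hmax n hn
    · have : 0 ≤ c p := hp
      linarith
  have hfin : {n | c p ≤ c n}.Finite := h.subset fun n hn => by
    have h1 : c p ≤ c n := hn
    have h2 : 0 ≤ c p := hp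
    exact h2.trans h1
  obtain ⟨m, hm, hmin⟩ := Set.exists_min_image _ id hfin ⟨p, by simp⟩
  have hm' : c p ≤ c m := hm
  refine ⟨m, fun n hn => ?_, fun n => (hmax' n).trans hm'⟩
  by_contra hcon
  push Not at hcon
  have := hmin n (hm'.trans hcon)
  simp at this
  omega

def BB : Set (ℤ → ℕ) := X0 ∩ {y | ∀ n, cc n y ≤ 0 ∧ (n < 0 → cc n y < 0)}

lemma meas_BB : MeasurableSet BB := by
  refine meas_X0.inter ?_
  have : {y : ℤ → ℕ | ∀ n, cc n y ≤ 0 ∧ (n < 0 → cc n y < 0)}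
      = ⋂ n : ℤ, ({y | cc n y ≤ 0} ∩ {y | n < 0 → cc n y < 0}) := by
    ext y; simp
  rw [this]
  refine MeasurableSet.iInter fun n => ?_
  refine (measurableSet_le (meas_cc n) measurable_const).inter ?_
  by_cases hn : n < 0
  · simpa [hn] using measurableSet_lt (meas_cc n) measurable_const
  · simp [hn]

lemma BB_ret {z : ℤ → ℕ} (hz : z ∈ BB) (m : ℤ) (hm : 0 < m) : (shift ^ m) z ∉ BB := by
  intro h
  have h1 := (h.2 (-m)).2 (by omega)
  rw [cc_shift hz.1, neg_add_cancel, cc_zero] at h1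
  have := (hz.2 m).1
  linarith

lemma disj_aux {m n : ℤ} (h : m < n) : Disjoint (⇑(shift ^ m) '' BB) (⇑(shift ^ n) '' BB) := by
  rw [Set.disjoint_left]
  rintro _ ⟨x, hx, rfl⟩ ⟨z, hz, hzx⟩
  apply BB_ret hz (n - m) (by omega)
  have : (shift ^ (n - m)) z = x := by
    apply (shift ^ m).injective
    rw [← hzx, ← Equiv.Perm.mul_apply, ← zpow_add]
    congr 2; ring
  rwa [this]

lemma main (a : ℝ) (ha : 4 < a) : TotallyDissipative shift (Measure.infinitePi (mu a)) := by
  refine ⟨BB, meas_BB, ?_, ?_⟩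
  · intro m n hmn
    rcases lt_or_gt_of_ne hmn with h | h
    · exact disj_aux h
    · exact (disj_aux h).symm
  · have : ∀ᵐ y ∂(Measure.infinitePi (mu a)), y ∈ ⋃ n : ℤ, ⇑(shift ^ n) '' BB := by
      filter_upwards [ae_X0 a (by linarith), ae_tsum a ha] with y hy hs
      have ht := ENNReal.tendsto_cofinite_zero_of_tsum_ne_top hs.ne
      have hev := ht.eventually (gt_mem_nhds (show (0:ℝ≥0∞) < 1 by simp))
      have hfin : {n | 0 ≤ cc n y}.Finite := by
        refine Set.Finite.subset hev fun n hn => ?_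
        have hn' : 0 ≤ cc n y := hn
        have : 0 ≤ cc n y / 2 := by linarith
        simpa using this
      obtain ⟨m, h1, h2⟩ := exists_first_max (fun n => cc n y) hfin (cc_zero y)
      refine Set.mem_iUnion.2 ⟨-m, (shift ^ m) y, ⟨X0_shift hy m, fun n => ?_⟩, ?_⟩
      · rw [cc_shift hy]
        refine ⟨by linarith [h2 (n + m)], fun hn => ?_⟩
        have := h1 (n + m) (by omega)
        linarith
      · rw [← Equiv.Perm.mul_apply, ← zpow_add]
        simp
    rw [← Set.compl_eq_univ_sdiff]
    exact this

end S16
/-- With `a_n := a e^{ε_n}` where `ε_n = -n^{-1/2}` for `n ≥ 2` and `ε_n = 0` for `n ≤ 1`: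
if `a > 4` then the shift on `(ℕ^ℤ, η)`, `η = ⊗_{n∈ℤ} Pois(a e^{ε_n})`, is totally
dissipative. -/
theorem stmt16 (a : ℝ) (ha : 4 < a)
    (η : Measure (ℤ → ℕ)) [IsProbabilityMeasure η]
    (hη : IsProductOf η fun n => pois (a * Real.exp (eps n))) :
    TotallyDissipative shift η := by
  have h := S16.eta_eq (S16.mu a) η hη
  rw [h]
  exact S16.main a ha
end
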